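/- Let T_1,…,T_N all be LSV maps, T_j = S_{α_j} with α_j > 0, assume α_min = min_j α_j < 1, and let p = (p_j) be a probability vector with strictly positive entries. Then there exists a unique absolutely continuous stationary probability measure μ_p for the random system, i.e. a unique Borel probability measure μ_p on [0,1] absolutely continuous with respect to Lebesgue measure λ satisfying Σ_{j=1}^N p_j μ_p(S_{α_j}⁻¹A) = μ_p(A) for all Borel sets A ⊆ [0,1]; moreover its density dμ_p/dλ is decreasing and continuous on (0,1] and there exists a > 0 such that dμ_p/dλ(x) ≤ a·x^{−α_min} for all x ∈ (0,1]. -/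

import Mathlib

open MeasureTheory Set

/-- Left branch of the LSV-type maps: `x ↦ x(1 + 2^α x^α)`. -/
noncomputable def lsvLeft (α x : ℝ) : ℝ := x * (1 + 2 ^ α * x ^ α)

/-- The LSV map `S_α`. -/
noncomputable def lsvMap (α : ℝ) (x : ℝ) : ℝ :=
  if x ≤ 1 / 2 then lsvLeft α x else 2 * x - 1

open Filter Topology

/-- The derivative of the left branch `lsvLeft`. -/
noncomputable def lsvSlope (α t : ℝ) : ℝ := 1 + (1 + α) * (2 ^ α * t ^ α)

/-- The inverse of the left branch `lsvLeft`, as a map from `[0,1]` to `[0,1/2]`. -/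
noncomputable def lsvInv (α x : ℝ) : ℝ := Function.invFunOn (lsvLeft α) (Icc 0 (1 / 2)) x

section Branch

variable {α : ℝ}

lemma lsvLeft_zero : lsvLeft α 0 = 0 := by simp [lsvLeft]

lemma two_rpow_mul_half_rpow : (2 : ℝ) ^ α * (1 / 2) ^ α = 1 := by
  rw [← Real.mul_rpow (by norm_num) (by norm_num)]; norm_num

lemma lsvLeft_half : lsvLeft α (1 / 2) = 1 := by
  rw [lsvLeft, two_rpow_mul_half_rpow]; norm_num

lemma one_le_lsvSlope (hα : 0 < α) {t : ℝ} (ht : 0 ≤ t) : 1 ≤ lsvSlope α t := by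
  have : 0 ≤ (1 + α) * (2 ^ α * t ^ α) := by positivity
  unfold lsvSlope; linarith

lemma lsvSlope_mono (hα : 0 < α) {s t : ℝ} (hs : 0 ≤ s) (hst : s ≤ t) :
    lsvSlope α s ≤ lsvSlope α t := by
  unfold lsvSlope; gcongr

/-- The left branch lies above its tangents. -/
lemma lsvSlope_mul_sub_le (hα : 0 < α) {s t : ℝ} (hs : 0 ≤ s) (ht : 0 ≤ t) :
    lsvSlope α s * (t - s) ≤ lsvLeft α t - lsvLeft α s := by
  have key : s ^ α * s + (1 + α) * s ^ α * (t - s) ≤ t ^ α * t := by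
    rcases hs.eq_or_lt with rfl | hs
    · rw [Real.zero_rpow hα.ne']; simp; positivity
    · have h := one_add_mul_self_le_rpow_one_add (s := t / s - 1) (p := 1 + α)
        (by have := div_nonneg ht hs.le; linarith) (by linarith)
      rw [add_sub_cancel, Real.div_rpow ht hs.le, le_div_iff₀ (by positivity),
        Real.rpow_add' hs.le (by linarith), Real.rpow_add' ht (by linarith),
        Real.rpow_one, Real.rpow_one] at h
      have e : (1 + (1 + α) * (t / s - 1)) * (s * s ^ α)
          = s ^ α * s + (1 + α) * s ^ α * (t - s) := by field_simp
      linarith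
  have := mul_le_mul_of_nonneg_left key (by positivity : (0 : ℝ) ≤ 2 ^ α)
  unfold lsvSlope lsvLeft
  nlinarith

lemma sub_le_lsvLeft_sub (hα : 0 < α) {s t : ℝ} (hs : 0 ≤ s) (hst : s ≤ t) :
    t - s ≤ lsvLeft α t - lsvLeft α s :=
  le_trans (le_mul_of_one_le_left (by linarith) (one_le_lsvSlope hα hs))
    (lsvSlope_mul_sub_le hα hs (hs.trans hst))

lemma sub_lt_lsvLeft_sub (hα : 0 < α) {s t : ℝ} (hs : 0 ≤ s) (hst : s < t) :
    t - s < lsvLeft α t - lsvLeft α s := by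
  have h1 := sub_le_lsvLeft_sub hα hs (show s ≤ (s + t) / 2 by linarith)
  have h2 := lsvSlope_mul_sub_le hα (show 0 ≤ (s + t) / 2 by linarith) (hs.trans hst.le)
  have h3 : 1 < lsvSlope α ((s + t) / 2) := by
    have : 0 < (s + t) / 2 := by linarith
    have : 0 < (1 + α) * (2 ^ α * ((s + t) / 2) ^ α) := by positivity
    unfold lsvSlope; linarith
  nlinarith

lemma lsvLeft_strictMonoOn (hα : 0 < α) : StrictMonoOn (lsvLeft α) (Ici 0) := by
  intro s hs t _ hst
  have := sub_lt_lsvLeft_sub hα hs hst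
  linarith

lemma continuous_lsvLeft (hα : 0 < α) : Continuous (lsvLeft α) := by
  have := Real.continuous_rpow_const hα.le
  unfold lsvLeft; fun_prop

lemma hasDerivAt_lsvLeft {t : ℝ} (ht : 0 < t) :
    HasDerivAt (lsvLeft α) (lsvSlope α t) t := by
  have h := (hasDerivAt_id t).mul
    (((Real.hasDerivAt_rpow_const (p := α) (Or.inl ht.ne')).const_mul (2 ^ α)).const_add 1)
  refine h.congr_deriv ?_
  rw [Real.rpow_sub_one ht.ne']
  simp only [id, lsvSlope]
  field_simp
  ring

lemma surjOn_lsvLeft (hα : 0 < α) : SurjOn (lsvLeft α) (Icc 0 (1 / 2)) (Icc 0 1) := by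
  have := intermediate_value_Icc (by norm_num : (0 : ℝ) ≤ 1 / 2)
    (continuous_lsvLeft hα).continuousOn
  rwa [lsvLeft_zero, lsvLeft_half] at this

lemma lsvInv_mem (hα : 0 < α) {x : ℝ} (hx : x ∈ Icc (0 : ℝ) 1) :
    lsvInv α x ∈ Icc (0 : ℝ) (1 / 2) :=
  Function.invFunOn_mem (surjOn_lsvLeft hα hx)

lemma lsvLeft_lsvInv (hα : 0 < α) {x : ℝ} (hx : x ∈ Icc (0 : ℝ) 1) :
    lsvLeft α (lsvInv α x) = x :=
  Function.invFunOn_eq (surjOn_lsvLeft hα hx)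

lemma lsvInv_eq (hα : 0 < α) {x t : ℝ} (hx : x ∈ Icc (0 : ℝ) 1) (ht : 0 ≤ t)
    (h : lsvLeft α t = x) : lsvInv α x = t :=
  (lsvLeft_strictMonoOn hα).injOn (lsvInv_mem hα hx).1 ht (by rw [lsvLeft_lsvInv hα hx, h])

lemma lsvInv_zero (hα : 0 < α) : lsvInv α 0 = 0 :=
  lsvInv_eq hα (by simp) le_rfl lsvLeft_zero

lemma lsvInv_one (hα : 0 < α) : lsvInv α 1 = 1 / 2 :=
  lsvInv_eq hα (by simp) (by norm_num) lsvLeft_half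

lemma lsvInv_le_iff (hα : 0 < α) {x t : ℝ} (hx : x ∈ Icc (0 : ℝ) 1) (ht : 0 ≤ t) :
    t ≤ lsvInv α x ↔ lsvLeft α t ≤ x := by
  conv_rhs => rw [← lsvLeft_lsvInv hα hx]
  exact ((lsvLeft_strictMonoOn hα).le_iff_le ht (lsvInv_mem hα hx).1).symm

lemma lsvInv_mono (hα : 0 < α) : MonotoneOn (lsvInv α) (Icc 0 1) := by
  intro x hx y hy hxy
  rw [lsvInv_le_iff hα hy (lsvInv_mem hα hx).1, lsvLeft_lsvInv hα hx]
  exact hxy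

lemma lsvInv_pos (hα : 0 < α) {x : ℝ} (hx : x ∈ Ioc (0 : ℝ) 1) : 0 < lsvInv α x := by
  have hx' := Ioc_subset_Icc_self hx
  refine (lsvInv_mem hα hx').1.lt_of_ne fun h => ?_
  have := lsvLeft_lsvInv hα hx'
  rw [← h, lsvLeft_zero] at this
  exact hx.1.ne this

lemma lsvInv_mem_Ioc (hα : 0 < α) {x : ℝ} (hx : x ∈ Ioc (0 : ℝ) 1) :
    lsvInv α x ∈ Ioc (0 : ℝ) 1 :=
  ⟨lsvInv_pos hα hx, (lsvInv_mem hα (Ioc_subset_Icc_self hx)).2.trans (by norm_num)⟩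

lemma lsvInv_mem_Icc (hα : 0 < α) {x : ℝ} (hx : x ∈ Icc (0 : ℝ) 1) :
    lsvInv α x ∈ Icc (0 : ℝ) 1 :=
  ⟨(lsvInv_mem hα hx).1, (lsvInv_mem hα hx).2.trans (by norm_num)⟩

lemma lsvInv_sub_le (hα : 0 < α) {x y : ℝ} (hx : x ∈ Icc (0 : ℝ) 1) (hy : y ∈ Icc (0 : ℝ) 1)
    (hxy : x ≤ y) : lsvInv α y - lsvInv α x ≤ y - x := by
  have := sub_le_lsvLeft_sub hα (lsvInv_mem hα hx).1 (lsvInv_mono hα hx hy hxy)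
  rwa [lsvLeft_lsvInv hα hx, lsvLeft_lsvInv hα hy] at this

lemma lsvInv_le_self (hα : 0 < α) {x : ℝ} (hx : x ∈ Icc (0 : ℝ) 1) : lsvInv α x ≤ x := by
  have := lsvInv_sub_le hα (by simp) hx hx.1
  rw [lsvInv_zero hα] at this
  linarith

lemma lsvInv_lipschitz (hα : 0 < α) : LipschitzOnWith 1 (lsvInv α) (Icc 0 1) := by
  refine LipschitzOnWith.of_le_add fun x hx y hy => ?_
  rw [Real.dist_eq]
  rcases le_total x y with h | h
  · exact (lsvInv_mono hα hx hy h).trans (le_add_of_nonneg_right (abs_nonneg _))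
  · have := lsvInv_sub_le hα hy hx h
    have := le_abs_self (x - y)
    linarith

lemma continuousOn_lsvInv (hα : 0 < α) : ContinuousOn (lsvInv α) (Icc 0 1) :=
  (lsvInv_lipschitz hα).continuousOn

lemma hasDerivAt_lsvInv (hα : 0 < α) {x : ℝ} (hx : x ∈ Ioo (0 : ℝ) 1) :
    HasDerivAt (lsvInv α) (lsvSlope α (lsvInv α x))⁻¹ x := by
  have hn : Icc (0 : ℝ) 1 ∈ 𝓝 x := Icc_mem_nhds hx.1 hx.2
  have hx' := Ioo_subset_Ioc_self hx
  refine HasDerivAt.of_local_left_inverse ((continuousOn_lsvInv hα).continuousAt hn)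
    (hasDerivAt_lsvLeft (lsvInv_pos hα hx')) ?_ ?_
  · have := one_le_lsvSlope hα (lsvInv_pos hα hx').le
    positivity
  · filter_upwards [hn] with y hy using lsvLeft_lsvInv hα hy

/-- The expansion of the left branch, in the form needed for `x ^ (1 + β) * f x` to be
monotone. -/
lemma rpow_div_slope_mono {β : ℝ} (hα : 0 < α) (hαβ : α ≤ β) {u v : ℝ} (hu : 0 ≤ u)
    (huv : u ≤ v) :
    (1 + u) ^ (1 + β) / (1 + (1 + α) * u) ≤ (1 + v) ^ (1 + β) / (1 + (1 + α) * v) := by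
  have hu1 : 0 < 1 + (1 + α) * u := by positivity
  have hv : 0 ≤ v := hu.trans huv
  have hv1 : 0 < 1 + (1 + α) * v := by positivity
  set r := (v - u) / (1 + u) with hr
  have hr0 : 0 ≤ r := div_nonneg (by linarith) (by linarith)
  have e : 1 + v = (1 + u) * (1 + r) := by rw [hr]; field_simp; ring
  have h1 : 1 + (1 + α) * r ≤ (1 + r) ^ (1 + β) :=
    (one_add_mul_self_le_rpow_one_add (by linarith) (by linarith)).trans
      (Real.rpow_le_rpow_of_exponent_le (by linarith) (by linarith))
  rw [e, Real.mul_rpow (by linarith) (by linarith), div_le_div_iff₀ hu1 hv1,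
    mul_assoc]
  refine mul_le_mul_of_nonneg_left ?_ (by positivity)
  refine le_trans ?_ (mul_le_mul_of_nonneg_right h1 hu1.le)
  have e2 : v = u + r * (1 + u) := by linarith
  rw [e2]
  have : 0 ≤ (1 + α) * α * r * u := by positivity
  nlinarith

lemma rpow_mul_div_slope_mono {β : ℝ} (hα : 0 < α) (hαβ : α ≤ β) {f : ℝ → ℝ}
    (hf : ∀ x ∈ Ioc (0 : ℝ) 1, 0 ≤ f x)
    (hm : MonotoneOn (fun x => x ^ (1 + β) * f x) (Ioc 0 1)) :
    MonotoneOn (fun x => x ^ (1 + β) * (f (lsvInv α x) / lsvSlope α (lsvInv α x)))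
      (Ioc 0 1) := by
  have e : ∀ x ∈ Ioc (0 : ℝ) 1, x ^ (1 + β) * (f (lsvInv α x) / lsvSlope α (lsvInv α x)) =
      (1 + 2 ^ α * lsvInv α x ^ α) ^ (1 + β) / (1 + (1 + α) * (2 ^ α * lsvInv α x ^ α)) *
        (lsvInv α x ^ (1 + β) * f (lsvInv α x)) := by
    intro x hx
    have hy := lsvInv_pos hα hx
    have h := lsvLeft_lsvInv hα (Ioc_subset_Icc_self hx)
    conv_lhs => enter [1]; rw [← h]
    rw [lsvLeft, Real.mul_rpow hy.le (by positivity), lsvSlope]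
    ring
  intro x hx y hy hxy
  have hx' := lsvInv_mem_Ioc hα hx
  have hy' := lsvInv_mem_Ioc hα hy
  have hm' := lsvInv_mono hα (Ioc_subset_Icc_self hx) (Ioc_subset_Icc_self hy) hxy
  have h0 := hx'.1
  simp only [e x hx, e y hy]
  refine mul_le_mul (rpow_div_slope_mono hα hαβ (by positivity) ?_) (hm hx' hy' hm') ?_ ?_
  · gcongr
  · exact mul_nonneg (by positivity) (hf _ hx')
  · have := hy'.1
    positivity

/-- Contraction of the inverse branch in terms of powers. -/
lemma lsvInv_rpow_le (hα : 0 < α) (hα1 : α < 1) {x : ℝ} (hx : x ∈ Icc (0 : ℝ) 1) :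
    lsvInv α x ^ (1 - α) ≤ x ^ (1 - α) - (1 - α) / 2 * x := by
  rcases hx.1.eq_or_lt with rfl | hx0
  · simp [lsvInv_zero hα]
  have hy := lsvInv_pos hα ⟨hx0, hx.2⟩
  have hy2 := (lsvInv_mem hα hx).2
  have h := lsvLeft_lsvInv hα hx
  set y := lsvInv α x
  rw [lsvLeft, ← Real.mul_rpow (by norm_num) hy.le] at h
  have h1 : (2 * y) ^ α ≤ 1 := Real.rpow_le_one (by linarith) (by linarith) hα.le
  have h2 : x ≤ 2 * y := by nlinarith
  have h3 : x ^ α ≤ (2 * y) ^ α := Real.rpow_le_rpow hx0.le h2 hα.le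
  have hu0 : 0 < x ^ α := by positivity
  have h4 : y ≤ x * (1 - x ^ α / 2) := by
    have : y * (1 + x ^ α) ≤ x := by nlinarith
    have h5 : 1 ≤ (1 + x ^ α) * (1 - x ^ α / 2) := by nlinarith
    have h6 : 0 ≤ 1 - x ^ α / 2 := by linarith
    calc y ≤ y * ((1 + x ^ α) * (1 - x ^ α / 2)) := le_mul_of_one_le_right hy.le h5
      _ = (y * (1 + x ^ α)) * (1 - x ^ α / 2) := by ring
      _ ≤ _ := mul_le_mul_of_nonneg_right this h6
  have h7 : (1 + -(x ^ α / 2)) ^ (1 - α) ≤ 1 + (1 - α) * -(x ^ α / 2) :=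
    rpow_one_add_le_one_add_mul_self (by linarith) (by linarith) (by linarith)
  calc y ^ (1 - α) ≤ (x * (1 - x ^ α / 2)) ^ (1 - α) :=
        Real.rpow_le_rpow hy.le h4 (by linarith)
    _ = x ^ (1 - α) * (1 + -(x ^ α / 2)) ^ (1 - α) := by
        rw [Real.mul_rpow hx0.le (by linarith)]; rfl
    _ ≤ x ^ (1 - α) * (1 + (1 - α) * -(x ^ α / 2)) := by gcongr
    _ = x ^ (1 - α) - (1 - α) / 2 * (x ^ (1 - α) * x ^ α) := by ring
    _ = _ := by rw [← Real.rpow_add hx0]; simp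

end Branch

/-- A pair of a distribution function `F` of mass `m` and a decreasing density `f` on `(0,1]`
for which `x ^ (1 + β) * f x` is increasing. -/
structure IsLsvPair (β m : ℝ) (F f : ℝ → ℝ) : Prop where
  zero : F 0 = 0
  one : F 1 = m
  nonneg : ∀ x ∈ Ioc (0 : ℝ) 1, 0 ≤ f x
  anti : AntitoneOn f (Ioc 0 1)
  mono : MonotoneOn (fun x => x ^ (1 + β) * f x) (Ioc 0 1)
  lower : ∀ x ∈ Icc (0 : ℝ) 1, ∀ y ∈ Ioc (0 : ℝ) 1, x ≤ y → f y * (y - x) ≤ F y - F x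
  upper : ∀ x ∈ Ioc (0 : ℝ) 1, ∀ y ∈ Ioc (0 : ℝ) 1, x ≤ y → F y - F x ≤ f x * (y - x)

namespace IsLsvPair

variable {β m m' : ℝ} {F f G g : ℝ → ℝ}

protected lemma add (h : IsLsvPair β m F f) (h' : IsLsvPair β m' G g) :
    IsLsvPair β (m + m') (F + G) (f + g) where
  zero := by simp [h.zero, h'.zero]
  one := by simp [h.one, h'.one]
  nonneg x hx := add_nonneg (h.nonneg x hx) (h'.nonneg x hx)
  anti := h.anti.add h'.anti
  mono := by
    have := h.mono.add h'.mono
    refine this.congr fun x _ => ?_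
    simp only [Pi.add_apply]; ring
  lower x hx y hy hxy := by
    have := h.lower x hx y hy hxy
    have := h'.lower x hx y hy hxy
    simp only [Pi.add_apply]; linarith
  upper x hx y hy hxy := by
    have := h.upper x hx y hy hxy
    have := h'.upper x hx y hy hxy
    simp only [Pi.add_apply]; linarith

protected lemma smul (h : IsLsvPair β m F f) {c : ℝ} (hc : 0 ≤ c) :
    IsLsvPair β (c * m) (c • F) (c • f) where
  zero := by simp [h.zero]
  one := by simp [h.one]
  nonneg x hx := mul_nonneg hc (h.nonneg x hx)
  anti x hx y hy hxy := mul_le_mul_of_nonneg_left (h.anti hx hy hxy) hc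
  mono x hx y hy hxy := by
    have := mul_le_mul_of_nonneg_left (h.mono hx hy hxy) hc
    simp only [Pi.smul_apply, smul_eq_mul] at this ⊢
    linarith
  lower x hx y hy hxy := by
    have := mul_le_mul_of_nonneg_left (h.lower x hx y hy hxy) hc
    simp only [Pi.smul_apply, smul_eq_mul]; linarith
  upper x hx y hy hxy := by
    have := mul_le_mul_of_nonneg_left (h.upper x hx y hy hxy) hc
    simp only [Pi.smul_apply, smul_eq_mul]; linarith

protected lemma sum {ι : Type*} (s : Finset ι) {μ : ι → ℝ} {Φ φ : ι → ℝ → ℝ}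
    (h : ∀ i ∈ s, IsLsvPair β (μ i) (Φ i) (φ i)) :
    IsLsvPair β (∑ i ∈ s, μ i) (∑ i ∈ s, Φ i) (∑ i ∈ s, φ i) := by
  classical
  induction s using Finset.induction_on with
  | empty =>
    simp only [Finset.sum_empty]
    exact ⟨rfl, rfl, fun _ _ => le_rfl, fun _ _ _ _ _ => le_rfl, by intro _ _ _ _ _; simp,
      by simp, by simp⟩
  | insert i s hi ih =>
    rw [Finset.sum_insert hi, Finset.sum_insert hi, Finset.sum_insert hi]
    exact (h i (Finset.mem_insert_self i s)).add
      (ih fun j hj => h j (Finset.mem_insert_of_mem hj))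

protected lemma of_tendsto {ι : Type*} {l : Filter ι} [l.NeBot] {Φ φ : ι → ℝ → ℝ}
    (h : ∀ i, IsLsvPair β m (Φ i) (φ i))
    (hF : ∀ x ∈ Icc (0 : ℝ) 1, Tendsto (fun i => Φ i x) l (𝓝 (F x)))
    (hf : ∀ x ∈ Ioc (0 : ℝ) 1, Tendsto (fun i => φ i x) l (𝓝 (f x))) :
    IsLsvPair β m F f where
  zero := by
    refine tendsto_nhds_unique (hF 0 (by simp)) ?_
    simp [(h _).zero]
  one := by
    refine tendsto_nhds_unique (hF 1 (by simp)) ?_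
    simp [(h _).one]
  nonneg x hx := ge_of_tendsto' (hf x hx) fun i => (h i).nonneg x hx
  anti x hx y hy hxy := le_of_tendsto_of_tendsto' (hf y hy) (hf x hx) fun i => (h i).anti hx hy hxy
  mono x hx y hy hxy := le_of_tendsto_of_tendsto' ((hf x hx).const_mul _) ((hf y hy).const_mul _)
    fun i => (h i).mono hx hy hxy
  lower x hx y hy hxy := le_of_tendsto_of_tendsto' ((hf y hy).mul_const _)
    ((hF y (Ioc_subset_Icc_self hy)).sub (hF x hx)) fun i => (h i).lower x hx y hy hxy
  upper x hx y hy hxy := le_of_tendsto_of_tendsto'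
    ((hF y (Ioc_subset_Icc_self hy)).sub (hF x (Ioc_subset_Icc_self hx)))
    ((hf x hx).mul_const _) fun i => (h i).upper x hx y hy hxy

lemma monotoneOn (h : IsLsvPair β m F f) : MonotoneOn F (Icc 0 1) := by
  intro x hx y hy hxy
  rcases hy.1.eq_or_lt with h0 | h0
  · rw [le_antisymm hxy (by rw [← h0]; exact hx.1)]
  · have hy' : y ∈ Ioc (0 : ℝ) 1 := ⟨h0, hy.2⟩
    have := h.lower x hx y hy' hxy
    have := mul_nonneg (h.nonneg y hy') (sub_nonneg.2 hxy)
    linarith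

lemma cdf_nonneg (h : IsLsvPair β m F f) {x : ℝ} (hx : x ∈ Icc (0 : ℝ) 1) : 0 ≤ F x := by
  have := h.monotoneOn (by simp) hx hx.1
  rwa [h.zero] at this

lemma cdf_le (h : IsLsvPair β m F f) {x : ℝ} (hx : x ∈ Icc (0 : ℝ) 1) : F x ≤ m := by
  have := h.monotoneOn hx (by simp) hx.2
  rwa [h.one] at this

lemma mul_le_cdf (h : IsLsvPair β m F f) {x : ℝ} (hx : x ∈ Ioc (0 : ℝ) 1) : f x * x ≤ F x := by
  have := h.lower 0 (by simp) x hx hx.1.le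
  rwa [h.zero, sub_zero, sub_zero] at this

lemma density_le (h : IsLsvPair β m F f) {x : ℝ} (hx : x ∈ Ioc (0 : ℝ) 1) : f x ≤ m / x := by
  rw [le_div_iff₀ hx.1]
  exact (h.mul_le_cdf hx).trans (h.cdf_le (Ioc_subset_Icc_self hx))

/-- Near `x₀`, the values of the density lie between `f x₀` and `f x₀ * (x₀ / t) ^ (1 + β)`. -/
lemma continuousOn (h : IsLsvPair β m F f) : ContinuousOn f (Ioc 0 1) := by
  intro x hx
  have hx0 : x ≠ 0 := hx.1.ne'
  have hB : Tendsto (fun t => f x * (x ^ (1 + β) / t ^ (1 + β))) (𝓝[Ioc 0 1] x) (𝓝 (f x)) := by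
    have : ContinuousAt (fun t => f x * (x ^ (1 + β) / t ^ (1 + β))) x :=
      continuousAt_const.mul (continuousAt_const.div
        (Real.continuousAt_rpow_const _ _ (Or.inl hx0)) (Real.rpow_pos_of_pos hx.1 _).ne')
    have := this.tendsto.mono_left (nhdsWithin_le_nhds (s := Ioc 0 1))
    rwa [div_self (Real.rpow_pos_of_pos hx.1 _).ne', mul_one] at this
  have hc : Tendsto (fun _ : ℝ => f x) (𝓝[Ioc 0 1] x) (𝓝 (f x)) := tendsto_const_nhds
  have hmin := hc.min hB
  have hmax := hc.max hB
  rw [min_self] at hmin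
  rw [max_self] at hmax
  refine tendsto_of_tendsto_of_tendsto_of_le_of_le' hmin hmax ?_ ?_
  · filter_upwards [self_mem_nhdsWithin] with t ht
    rcases le_total t x with htx | htx
    · exact (min_le_left _ _).trans (h.anti ht hx htx)
    · refine (min_le_right _ _).trans ?_
      have := h.mono hx ht htx
      have ht0 := Real.rpow_pos_of_pos ht.1 (1 + β)
      rw [← mul_div_assoc, div_le_iff₀ ht0]
      simp only at this
      linarith
  · filter_upwards [self_mem_nhdsWithin] with t ht
    rcases le_total t x with htx | htx
    · refine le_trans ?_ (le_max_right _ _)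
      have := h.mono ht hx htx
      have ht0 := Real.rpow_pos_of_pos ht.1 (1 + β)
      rw [← mul_div_assoc, le_div_iff₀ ht0]
      simp only at this
      linarith
    · exact (h.anti hx ht htx).trans (le_max_left _ _)

lemma hasDerivWithinAt (h : IsLsvPair β m F f) {x : ℝ} (hx : x ∈ Ioc (0 : ℝ) 1) :
    HasDerivWithinAt F (f x) (Ioc 0 1) x := by
  rw [hasDerivWithinAt_iff_tendsto_slope]
  have hf : Tendsto f (𝓝[Ioc 0 1 \ {x}] x) (𝓝 (f x)) :=
    (h.continuousOn x hx).mono_left (nhdsWithin_mono _ sdiff_subset)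
  have hc : Tendsto (fun _ : ℝ => f x) (𝓝[Ioc 0 1 \ {x}] x) (𝓝 (f x)) := tendsto_const_nhds
  have hmin := hc.min hf
  have hmax := hc.max hf
  rw [min_self] at hmin
  rw [max_self] at hmax
  refine tendsto_of_tendsto_of_tendsto_of_le_of_le' hmin hmax ?_ ?_
  · filter_upwards [self_mem_nhdsWithin] with t ⟨ht, htx⟩
    rcases lt_or_gt_of_ne htx with htx | htx
    · refine (min_le_left _ _).trans ?_
      rw [slope_comm, slope_def_field, le_div_iff₀ (by linarith)]
      exact h.lower t (Ioc_subset_Icc_self ht) x hx htx.le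
    · refine (min_le_right _ _).trans ?_
      rw [slope_def_field, le_div_iff₀ (by linarith)]
      exact h.lower x (Ioc_subset_Icc_self hx) t ht htx.le
  · filter_upwards [self_mem_nhdsWithin] with t ⟨ht, htx⟩
    rcases lt_or_gt_of_ne htx with htx | htx
    · refine le_trans ?_ (le_max_right _ _)
      rw [slope_comm, slope_def_field, div_le_iff₀ (by linarith)]
      exact h.upper t ht x hx htx.le
    · refine le_trans ?_ (le_max_left _ _)
      rw [slope_def_field, div_le_iff₀ (by linarith)]
      exact h.upper x hx t ht htx.le

lemma hasDerivAt (h : IsLsvPair β m F f) {x : ℝ} (hx : x ∈ Ioo (0 : ℝ) 1) :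
    HasDerivAt F (f x) x :=
  (h.hasDerivWithinAt (Ioo_subset_Ioc_self hx)).hasDerivAt (Ioc_mem_nhds hx.1 hx.2)

lemma cdf_continuousOn (h : IsLsvPair β m F f) {a γ : ℝ} (hγ : γ < 1)
    (hb : ∀ x ∈ Icc (0 : ℝ) 1, F x ≤ a * x ^ (1 - γ)) : ContinuousOn F (Icc 0 1) := by
  intro x hx
  rcases hx.1.eq_or_lt with rfl | hx0
  · have hlim : Tendsto (fun t : ℝ => a * t ^ (1 - γ)) (𝓝[Icc 0 1] 0) (𝓝 0) := by
      have : ContinuousAt (fun t : ℝ => a * t ^ (1 - γ)) 0 :=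
        continuousAt_const.mul (Real.continuousAt_rpow_const _ _ (Or.inr (by linarith)))
      have := this.tendsto.mono_left (nhdsWithin_le_nhds (s := Icc 0 1))
      rwa [Real.zero_rpow (by linarith), mul_zero] at this
    rw [ContinuousWithinAt, h.zero]
    refine tendsto_of_tendsto_of_tendsto_of_le_of_le' tendsto_const_nhds hlim ?_ ?_
    · filter_upwards [self_mem_nhdsWithin] with t ht using h.cdf_nonneg ht
    · filter_upwards [self_mem_nhdsWithin] with t ht using hb t ht
  · have := (h.hasDerivWithinAt ⟨hx0, hx.2⟩).continuousWithinAt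
    refine this.mono_of_mem_nhdsWithin ?_
    filter_upwards [self_mem_nhdsWithin, mem_nhdsWithin_of_mem_nhds (lt_mem_nhds hx0)]
      with t ht ht0 using ⟨ht0, ht.2⟩

lemma intervalIntegrable (h : IsLsvPair β m F f) {a γ : ℝ} (hγ : γ < 1)
    (hb : ∀ x ∈ Icc (0 : ℝ) 1, F x ≤ a * x ^ (1 - γ)) : IntervalIntegrable f volume 0 1 := by
  rw [intervalIntegrable_iff_integrableOn_Ioc_of_le zero_le_one]
  refine intervalIntegral.integrableOn_deriv_of_nonneg (h.cdf_continuousOn hγ hb)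
    (fun x hx => h.hasDerivAt hx) fun x hx => h.nonneg x (Ioo_subset_Ioc_self hx)

lemma integral_eq (h : IsLsvPair β m F f) {a γ : ℝ} (hγ : γ < 1)
    (hb : ∀ x ∈ Icc (0 : ℝ) 1, F x ≤ a * x ^ (1 - γ)) {x : ℝ} (hx : x ∈ Icc (0 : ℝ) 1) :
    ∫ t in (0 : ℝ)..x, f t = F x := by
  rw [intervalIntegral.integral_eq_sub_of_hasDerivAt_of_le hx.1
    ((h.cdf_continuousOn hγ hb).mono (Icc_subset_Icc_right hx.2))
    (fun t ht => h.hasDerivAt ⟨ht.1, ht.2.trans_le hx.2⟩), h.zero, sub_zero]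
  refine (h.intervalIntegrable hγ hb).mono_set ?_
  rw [uIcc_of_le hx.1, uIcc_of_le zero_le_one]
  exact Icc_subset_Icc_right hx.2

/-- A continuous density satisfying the monotonicity conditions gives a pair. -/
lemma of_continuous (hf : Continuous f) (hnn : ∀ x ∈ Ioc (0 : ℝ) 1, 0 ≤ f x)
    (hanti : AntitoneOn f (Ioc 0 1))
    (hmono : MonotoneOn (fun x => x ^ (1 + β) * f x) (Ioc 0 1)) :
    IsLsvPair β (∫ t in (0 : ℝ)..1, f t) (fun x => ∫ t in (0 : ℝ)..x, f t) f where
  zero := by simp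
  one := rfl
  nonneg := hnn
  anti := hanti
  mono := hmono
  lower x hx y hy hxy := by
    rw [intervalIntegral.integral_interval_sub_left (hf.intervalIntegrable _ _)
      (hf.intervalIntegrable _ _)]
    have := intervalIntegral.integral_mono_on_of_le_Ioo (f := fun _ => f y) (g := f) (μ := volume)
      hxy (by simp) (hf.intervalIntegrable _ _)
      (fun t ht => hanti ⟨hx.1.trans_lt ht.1, ht.2.le.trans hy.2⟩ hy ht.2.le)
    simp only [intervalIntegral.integral_const, smul_eq_mul] at this
    linarith
  upper x hx y hy hxy := by
    rw [intervalIntegral.integral_interval_sub_left (hf.intervalIntegrable _ _)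
      (hf.intervalIntegrable _ _)]
    have := intervalIntegral.integral_mono_on_of_le_Ioo (g := fun _ => f x) (f := f) (μ := volume)
      hxy (hf.intervalIntegrable _ _) (by simp)
      (fun t ht => hanti hx ⟨hx.1.trans ht.1, ht.2.le.trans hy.2⟩ ht.1.le)
    simp only [intervalIntegral.integral_const, smul_eq_mul] at this
    linarith

/-- One branch of the transfer operator preserves the class of pairs. -/
lemma branch {α : ℝ} (h : IsLsvPair β m F f) (hα : 0 < α) (hαβ : α ≤ β) :
    IsLsvPair β m (fun x => F (lsvInv α x) + F ((x + 1) / 2) - F (1 / 2))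
      (fun x => f (lsvInv α x) / lsvSlope α (lsvInv α x) + f ((x + 1) / 2) / 2) where
  zero := by simp [lsvInv_zero hα, h.zero]
  one := by simp [lsvInv_one hα, h.one]
  nonneg x hx := by
    have h1 := h.nonneg _ (lsvInv_mem_Ioc hα hx)
    have h2 := h.nonneg ((x + 1) / 2) ⟨by linarith [hx.1], by linarith [hx.2]⟩
    have := one_le_lsvSlope hα (lsvInv_pos hα hx).le
    positivity
  anti x hx y hy hxy := by
    have h1 := h.anti (lsvInv_mem_Ioc hα hx) (lsvInv_mem_Ioc hα hy)
      (lsvInv_mono hα (Ioc_subset_Icc_self hx) (Ioc_subset_Icc_self hy) hxy)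
    have h2 := h.anti (show (x + 1) / 2 ∈ Ioc (0 : ℝ) 1 from
      ⟨by linarith [hx.1], by linarith [hx.2]⟩) (show (y + 1) / 2 ∈ Ioc (0 : ℝ) 1 from
      ⟨by linarith [hy.1], by linarith [hy.2]⟩) (by linarith)
    have h3 := one_le_lsvSlope hα (lsvInv_pos hα hx).le
    have h4 := lsvSlope_mono hα (lsvInv_pos hα hx).le
      (lsvInv_mono hα (Ioc_subset_Icc_self hx) (Ioc_subset_Icc_self hy) hxy)
    have h5 := h.nonneg _ (lsvInv_mem_Ioc hα hx)
    dsimp only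
    gcongr
  mono := by
    have h1 := rpow_mul_div_slope_mono hα hαβ h.nonneg h.mono
    have hβ : 0 < 1 + β := by linarith
    have h2 : MonotoneOn (fun x => x ^ (1 + β) * (f ((x + 1) / 2) / 2)) (Ioc (0 : ℝ) 1) := by
      intro x hx y hy hxy
      have hzx : (x + 1) / 2 ∈ Ioc (0 : ℝ) 1 := ⟨by linarith [hx.1], by linarith [hx.2]⟩
      have hzy : (y + 1) / 2 ∈ Ioc (0 : ℝ) 1 := ⟨by linarith [hy.1], by linarith [hy.2]⟩
      have e : ∀ x : ℝ, 0 < x → x ^ (1 + β) * (f ((x + 1) / 2) / 2) =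
          (x / ((x + 1) / 2)) ^ (1 + β) / 2 * (((x + 1) / 2) ^ (1 + β) * f ((x + 1) / 2)) := by
        intro x hx
        rw [Real.div_rpow hx.le (by linarith)]
        have : (0 : ℝ) < ((x + 1) / 2) ^ (1 + β) := Real.rpow_pos_of_pos (by linarith) _
        field_simp
      simp only [e x hx.1, e y hy.1]
      have hx0 := hx.1
      have hy0 := hy.1
      refine mul_le_mul ?_ (h.mono hzx hzy (by linarith)) ?_ (by positivity)
      · have : x / ((x + 1) / 2) ≤ y / ((y + 1) / 2) := by
          rw [div_le_div_iff₀ (by linarith) (by linarith)]; nlinarith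
        gcongr
      · exact mul_nonneg (by positivity) (h.nonneg _ hzx)
    exact (h1.add h2).congr fun x _ => by simp only; ring
  lower x hx y hy hxy := by
    have hy' := Ioc_subset_Icc_self hy
    have hm := lsvInv_mono hα hx hy' hxy
    have h1 := h.lower _ (lsvInv_mem_Icc hα hx) _ (lsvInv_mem_Ioc hα hy) hm
    have h2 := h.lower ((x + 1) / 2) ⟨by linarith [hx.1], by linarith [hx.2]⟩
      ((y + 1) / 2) ⟨by linarith [hy.1], by linarith [hy.2]⟩ (by linarith)
    have h3 := lsvSlope_mul_sub_le hα (lsvInv_mem hα hy').1 (lsvInv_mem hα hx).1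
    rw [lsvLeft_lsvInv hα hx, lsvLeft_lsvInv hα hy'] at h3
    have h4 := one_le_lsvSlope hα (lsvInv_mem hα hy').1
    have h5 := h.nonneg _ (lsvInv_mem_Ioc hα hy)
    have h6 : f (lsvInv α y) / lsvSlope α (lsvInv α y) * (y - x)
        ≤ f (lsvInv α y) * (lsvInv α y - lsvInv α x) := by
      rw [div_mul_eq_mul_div, div_le_iff₀ (by linarith), mul_assoc]
      exact mul_le_mul_of_nonneg_left (by linarith) h5
    linarith
  upper x hx y hy hxy := by
    have hx' := Ioc_subset_Icc_self hx
    have hy' := Ioc_subset_Icc_self hy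
    have hm := lsvInv_mono hα hx' hy' hxy
    have h1 := h.upper _ (lsvInv_mem_Ioc hα hx) _ (lsvInv_mem_Ioc hα hy) hm
    have h2 := h.upper ((x + 1) / 2) ⟨by linarith [hx.1], by linarith [hx.2]⟩
      ((y + 1) / 2) ⟨by linarith [hy.1], by linarith [hy.2]⟩ (by linarith)
    have h3 := lsvSlope_mul_sub_le hα (lsvInv_mem hα hx').1 (lsvInv_mem hα hy').1
    rw [lsvLeft_lsvInv hα hx', lsvLeft_lsvInv hα hy'] at h3
    have h4 := one_le_lsvSlope hα (lsvInv_mem hα hx').1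
    have h5 := h.nonneg _ (lsvInv_mem_Ioc hα hx)
    have h6 : f (lsvInv α x) * (lsvInv α y - lsvInv α x)
        ≤ f (lsvInv α x) / lsvSlope α (lsvInv α x) * (y - x) := by
      rw [div_mul_eq_mul_div, le_div_iff₀ (by linarith), mul_assoc]
      exact mul_le_mul_of_nonneg_left (by linarith) h5
    linarith

end IsLsvPair

/-- The action of the random system on distribution functions on `[0,1]`. -/
noncomputable def cdfTransfer {N : ℕ} (α p : Fin N → ℝ) : Module.End ℝ (ℝ → ℝ) where
  toFun F x := ∑ j, p j * (F (lsvInv (α j) x) + F ((x + 1) / 2) - F (1 / 2))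
  map_add' F G := by
    ext x
    simp only [Pi.add_apply, ← Finset.sum_add_distrib]
    exact Finset.sum_congr rfl fun j _ => by ring
  map_smul' c F := by
    ext x
    simp only [Pi.smul_apply, smul_eq_mul, Finset.mul_sum, RingHom.id_apply]
    exact Finset.sum_congr rfl fun j _ => by ring

/-- The action of the random system on densities on `(0,1]`. -/
noncomputable def densityTransfer {N : ℕ} (α p : Fin N → ℝ) : Module.End ℝ (ℝ → ℝ) where
  toFun f x := ∑ j, p j * (f (lsvInv (α j) x) / lsvSlope (α j) (lsvInv (α j) x)
    + f ((x + 1) / 2) / 2)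
  map_add' F G := by
    ext x
    simp only [Pi.add_apply, ← Finset.sum_add_distrib]
    exact Finset.sum_congr rfl fun j _ => by ring
  map_smul' c F := by
    ext x
    simp only [Pi.smul_apply, smul_eq_mul, Finset.mul_sum, RingHom.id_apply]
    exact Finset.sum_congr rfl fun j _ => by ring

lemma cdfTransfer_apply {N : ℕ} (α p : Fin N → ℝ) (F : ℝ → ℝ) (x : ℝ) :
    cdfTransfer α p F x = ∑ j, p j * (F (lsvInv (α j) x) + F ((x + 1) / 2) - F (1 / 2)) := rfl

lemma densityTransfer_apply {N : ℕ} (α p : Fin N → ℝ) (f : ℝ → ℝ) (x : ℝ) :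
    densityTransfer α p f x = ∑ j, p j * (f (lsvInv (α j) x) / lsvSlope (α j) (lsvInv (α j) x)
      + f ((x + 1) / 2) / 2) := rfl

/-- The Cesàro means of the powers of a linear operator on functions. -/
noncomputable def cesaroMean (T : Module.End ℝ (ℝ → ℝ)) (n : ℕ) : Module.End ℝ (ℝ → ℝ) :=
  ((n : ℝ) + 1)⁻¹ • ∑ k ∈ Finset.range (n + 1), T ^ k

lemma cesaroMean_apply (T : Module.End ℝ (ℝ → ℝ)) (n : ℕ) (F : ℝ → ℝ) :
    cesaroMean T n F = ((n : ℝ) + 1)⁻¹ • ∑ k ∈ Finset.range (n + 1), (T ^ k) F := by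
  simp [cesaroMean]

lemma apply_cesaroMean (T : Module.End ℝ (ℝ → ℝ)) (n : ℕ) (F : ℝ → ℝ) (x : ℝ) :
    T (cesaroMean T n F) x =
      cesaroMean T n F x + ((n : ℝ) + 1)⁻¹ * ((T ^ (n + 1)) F x - F x) := by
  have h := congrArg (fun S : Module.End ℝ (ℝ → ℝ) => ((n : ℝ) + 1)⁻¹ * S F x)
    (mul_geom_sum T (n + 1))
  simp only [sub_mul, one_mul, LinearMap.sub_apply, Pi.sub_apply, Module.End.mul_apply,
    Module.End.one_apply] at h
  rw [cesaroMean, LinearMap.smul_apply, map_smul, Pi.smul_apply, Pi.smul_apply, smul_eq_mul,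
    smul_eq_mul]
  linarith

/-- A pair satisfying in addition the bound `F x ≤ a * x ^ (1 - γ)`. -/
structure IsLsvCone (β γ m a : ℝ) (F f : ℝ → ℝ) : Prop extends IsLsvPair β m F f where
  bound : ∀ x ∈ Icc (0 : ℝ) 1, F x ≤ a * x ^ (1 - γ)

namespace IsLsvCone

variable {β γ m m' a a' : ℝ} {F f G g : ℝ → ℝ}

protected lemma smul (h : IsLsvCone β γ m a F f) {c : ℝ} (hc : 0 ≤ c) :
    IsLsvCone β γ (c * m) (c * a) (c • F) (c • f) where
  toIsLsvPair := h.toIsLsvPair.smul hc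
  bound x hx := by
    have := mul_le_mul_of_nonneg_left (h.bound x hx) hc
    simp only [Pi.smul_apply, smul_eq_mul]; linarith

protected lemma mono_bound (h : IsLsvCone β γ m a F f) (ha : a ≤ a') :
    IsLsvCone β γ m a' F f where
  toIsLsvPair := h.toIsLsvPair
  bound x hx := (h.bound x hx).trans
    (mul_le_mul_of_nonneg_right ha (Real.rpow_nonneg hx.1 _))

protected lemma sum {ι : Type*} (s : Finset ι) {Φ φ : ι → ℝ → ℝ}
    (h : ∀ i ∈ s, IsLsvCone β γ m a (Φ i) (φ i)) :
    IsLsvCone β γ (s.card * m) (s.card * a) (∑ i ∈ s, Φ i) (∑ i ∈ s, φ i) where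
  toIsLsvPair := by
    have := IsLsvPair.sum s (fun i hi => (h i hi).toIsLsvPair)
    rwa [Finset.sum_const, nsmul_eq_mul] at this
  bound x hx := by
    rw [Finset.sum_apply, mul_assoc, ← nsmul_eq_mul]
    exact Finset.sum_le_card_nsmul _ _ _ fun i hi => (h i hi).bound x hx

lemma of_continuous (hf : Continuous f) (hnn : ∀ x ∈ Ioc (0 : ℝ) 1, 0 ≤ f x)
    (hanti : AntitoneOn f (Ioc 0 1))
    (hmono : MonotoneOn (fun x => x ^ (1 + β) * f x) (Ioc 0 1)) (hγ0 : 0 < γ)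
    (ha0 : 0 ≤ a) (ha : ∀ x ∈ Ioc (0 : ℝ) 1, f x ≤ a) :
    IsLsvCone β γ (∫ t in (0 : ℝ)..1, f t) a (fun x => ∫ t in (0 : ℝ)..x, f t) f where
  toIsLsvPair := .of_continuous hf hnn hanti hmono
  bound x hx := by
    have := intervalIntegral.integral_mono_on_of_le_Ioo (g := fun _ => a) (f := f) (μ := volume)
      hx.1 (hf.intervalIntegrable _ _) (by simp)
      (fun t ht => ha t ⟨ht.1, ht.2.le.trans hx.2⟩)
    simp only [intervalIntegral.integral_const, smul_eq_mul, sub_zero] at this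
    refine this.trans ?_
    rw [mul_comm]
    refine mul_le_mul_of_nonneg_left ?_ ha0
    rcases hx.1.eq_or_lt with rfl | hx0
    · exact Real.rpow_nonneg le_rfl _
    · conv_lhs => rw [← Real.rpow_one x]
      exact Real.rpow_le_rpow_of_exponent_ge hx0 hx.2 (by linarith)

end IsLsvCone

section Transfer

variable {N : ℕ} {α p : Fin N → ℝ} {β γ m a : ℝ} {F f : ℝ → ℝ}

lemma IsLsvPair.transfer (hα : ∀ j, 0 < α j) (hp : ∀ j, 0 < p j) (hp1 : ∑ j, p j = 1)
    (hβ : ∀ j, α j ≤ β) (h : IsLsvPair β m F f) :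
    IsLsvPair β m (cdfTransfer α p F) (densityTransfer α p f) := by
  have := IsLsvPair.sum Finset.univ fun j _ => (h.branch (hα j) (hβ j)).smul (hp j).le
  rw [← Finset.sum_mul, hp1, one_mul] at this
  convert this using 1
  · ext x; simp [cdfTransfer]
  · ext x; simp [densityTransfer]

lemma IsLsvCone.transfer (hα : ∀ j, 0 < α j) (hp : ∀ j, 0 < p j) (hp1 : ∑ j, p j = 1)
    (hβ : ∀ j, α j ≤ β) (i : Fin N) (hi : α i < 1)
    (ha : m ≤ p i * ((1 - α i) / 2) * a) (h : IsLsvCone β (α i) m a F f) :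
    IsLsvCone β (α i) m a (cdfTransfer α p F) (densityTransfer α p f) where
  toIsLsvPair := h.toIsLsvPair.transfer hα hp hp1 hβ
  bound x hx := by
    have hm : 0 ≤ m := by simpa [h.one] using h.cdf_nonneg (x := 1) (by simp)
    have ha0 : 0 ≤ a := by
      have := (h.cdf_nonneg (x := 1) (by simp)).trans (h.bound 1 (by simp))
      simpa using this
    have hR : F ((x + 1) / 2) - F (1 / 2) ≤ m * x := by
      have h1 := h.upper (1 / 2) (by norm_num) ((x + 1) / 2)
        ⟨by linarith [hx.1], by linarith [hx.2]⟩ (by linarith [hx.1])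
      have h2 := h.density_le (x := 1 / 2) (by norm_num)
      have := mul_le_mul_of_nonneg_right h2 (show 0 ≤ (x + 1) / 2 - 1 / 2 by linarith [hx.1])
      linarith
    have hL : ∀ j, F (lsvInv (α j) x) ≤
        a * x ^ (1 - α i) - if j = i then a * ((1 - α i) / 2) * x else 0 := by
      intro j
      refine (h.bound _ (lsvInv_mem_Icc (hα j) hx)).trans ?_
      split_ifs with hj
      · subst hj
        have := mul_le_mul_of_nonneg_left (lsvInv_rpow_le (hα j) hi hx) ha0
        linarith
      · rw [sub_zero]
        exact mul_le_mul_of_nonneg_left (Real.rpow_le_rpow (lsvInv_mem (hα j) hx).1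
          (lsvInv_le_self (hα j) hx) (by linarith)) ha0
    have hsum : cdfTransfer α p F x ≤ ∑ j, p j * (a * x ^ (1 - α i) + m * x -
        if j = i then a * ((1 - α i) / 2) * x else 0) := by
      rw [cdfTransfer_apply]
      exact Finset.sum_le_sum fun j _ => mul_le_mul_of_nonneg_left (by linarith [hL j]) (hp j).le
    have e : ∑ j, p j * (a * x ^ (1 - α i) + m * x -
        if j = i then a * ((1 - α i) / 2) * x else 0) =
        a * x ^ (1 - α i) + m * x - p i * (a * ((1 - α i) / 2) * x) := by
      simp only [mul_sub, Finset.sum_sub_distrib, ← Finset.sum_mul, hp1, one_mul, mul_ite,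
        mul_zero, Finset.sum_ite_eq', Finset.mem_univ, if_true]
    rw [e] at hsum
    have := mul_le_mul_of_nonneg_right ha hx.1
    linarith

lemma IsLsvCone.transfer_pow (hα : ∀ j, 0 < α j) (hp : ∀ j, 0 < p j) (hp1 : ∑ j, p j = 1)
    (hβ : ∀ j, α j ≤ β) (i : Fin N) (hi : α i < 1)
    (ha : m ≤ p i * ((1 - α i) / 2) * a) (h : IsLsvCone β (α i) m a F f) (k : ℕ) :
    IsLsvCone β (α i) m a ((cdfTransfer α p ^ k) F) ((densityTransfer α p ^ k) f) := by
  induction k with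
  | zero => simpa using h
  | succ k ih =>
    rw [pow_succ', pow_succ', Module.End.mul_apply, Module.End.mul_apply]
    exact ih.transfer hα hp hp1 hβ i hi ha

lemma IsLsvCone.cesaro (hα : ∀ j, 0 < α j) (hp : ∀ j, 0 < p j) (hp1 : ∑ j, p j = 1)
    (hβ : ∀ j, α j ≤ β) (i : Fin N) (hi : α i < 1)
    (ha : m ≤ p i * ((1 - α i) / 2) * a) (h : IsLsvCone β (α i) m a F f) (n : ℕ) :
    IsLsvCone β (α i) m a (cesaroMean (cdfTransfer α p) n F)
      (cesaroMean (densityTransfer α p) n f) := by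
  have := (IsLsvCone.sum (Finset.range (n + 1)) fun k _ =>
    h.transfer_pow hα hp hp1 hβ i hi ha k).smul
    (show (0 : ℝ) ≤ ((n : ℝ) + 1)⁻¹ by positivity)
  rw [Finset.card_range] at this
  push_cast at this
  rwa [inv_mul_cancel_left₀ (by positivity), inv_mul_cancel_left₀ (by positivity),
    ← cesaroMean_apply, ← cesaroMean_apply] at this

lemma tendsto_inv_mul_of_bounded {l : Filter ℕ} (hl : l ≤ atTop) {u : ℕ → ℝ} {C : ℝ}
    (hu : ∀ n, |u n| ≤ C) : Tendsto (fun n : ℕ => ((n : ℝ) + 1)⁻¹ * u n) l (𝓝 0) := by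
  have h1 : Tendsto (fun n : ℕ => ((n : ℝ) + 1)⁻¹) l (𝓝 0) := by
    have := (tendsto_one_div_add_atTop_nhds_zero_nat (𝕜 := ℝ)).mono_left hl
    simpa using this
  exact h1.zero_mul_isBoundedUnder_le (isBoundedUnder_of ⟨C, hu⟩)

/-- Along a nonprincipal ultrafilter, the Cesàro means converge to a fixed point. -/
lemma IsLsvCone.exists_fixed (hα : ∀ j, 0 < α j) (hp : ∀ j, 0 < p j) (hp1 : ∑ j, p j = 1)
    (hβ : ∀ j, α j ≤ β) (i : Fin N) (hi : α i < 1)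
    (ha : m ≤ p i * ((1 - α i) / 2) * a) (h : IsLsvCone β (α i) m a F f) :
    ∃ G g : ℝ → ℝ, IsLsvCone β (α i) m a G g ∧
      (∀ x ∈ Icc (0 : ℝ) 1, Tendsto (fun n => cesaroMean (cdfTransfer α p) n F x)
        (hyperfilter ℕ) (𝓝 (G x))) ∧
      (∀ x ∈ Icc (0 : ℝ) 1, cdfTransfer α p G x = G x) ∧
      ∀ x ∈ Ioc (0 : ℝ) 1, densityTransfer α p g x = g x := by
  have hc := h.cesaro hα hp hp1 hβ i hi ha
  have hk := h.transfer_pow hα hp hp1 hβ i hi ha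
  have hU : (hyperfilter ℕ : Filter ℕ) ≤ atTop := Nat.hyperfilter_le_atTop
  have hlim : ∀ (u : ℕ → ℝ) (C : ℝ), (∀ n, u n ∈ Icc 0 C) →
      ∃ c, Tendsto u (hyperfilter ℕ) (𝓝 c) := by
    intro u C hu
    obtain ⟨c, -, hc⟩ := (isCompact_Icc (a := (0 : ℝ)) (b := C)).ultrafilter_le_nhds
      ((hyperfilter ℕ).map u) (le_principal_iff.2 (Filter.mem_map.2 (Filter.univ_mem' hu)))
    exact ⟨c, hc⟩
  have hG : ∀ x, ∃ c, x ∈ Icc (0 : ℝ) 1 →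
      Tendsto (fun n => cesaroMean (cdfTransfer α p) n F x) (hyperfilter ℕ) (𝓝 c) := by
    intro x
    by_cases hx : x ∈ Icc (0 : ℝ) 1
    · obtain ⟨c, hc⟩ := hlim _ m fun n => ⟨(hc n).cdf_nonneg hx, (hc n).cdf_le hx⟩
      exact ⟨c, fun _ => hc⟩
    · exact ⟨0, fun h => (hx h).elim⟩
  have hg : ∀ x, ∃ c, x ∈ Ioc (0 : ℝ) 1 →
      Tendsto (fun n => cesaroMean (densityTransfer α p) n f x) (hyperfilter ℕ) (𝓝 c) := by
    intro x
    by_cases hx : x ∈ Ioc (0 : ℝ) 1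
    · obtain ⟨c, hc⟩ := hlim _ (m / x) fun n => ⟨(hc n).nonneg x hx, (hc n).density_le hx⟩
      exact ⟨c, fun _ => hc⟩
    · exact ⟨0, fun h => (hx h).elim⟩
  choose G hG using hG
  choose g hg using hg
  refine ⟨G, g, ⟨.of_tendsto (fun n => (hc n).toIsLsvPair) hG hg, fun x hx =>
    le_of_tendsto' (hG x hx) fun n => (hc n).bound x hx⟩, hG, fun x hx => ?_, fun x hx => ?_⟩
  · have hz : (x + 1) / 2 ∈ Icc (0 : ℝ) 1 := ⟨by linarith [hx.1], by linarith [hx.2]⟩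
    have h1 : Tendsto (fun n => cdfTransfer α p (cesaroMean (cdfTransfer α p) n F) x)
        (hyperfilter ℕ) (𝓝 (cdfTransfer α p G x)) := by
      simp only [cdfTransfer_apply]
      exact tendsto_finsetSum _ fun j _ => (((hG _ (lsvInv_mem_Icc (hα j) hx)).add (hG _ hz)).sub
        (hG _ (by norm_num))).const_mul _
    simp only [apply_cesaroMean] at h1
    refine tendsto_nhds_unique h1 ?_
    have h2 := (hG x hx).add (tendsto_inv_mul_of_bounded hU (C := m)
      (u := fun n => (cdfTransfer α p ^ (n + 1)) F x - F x) fun n => ?_)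
    · rwa [add_zero] at h2
    · have := (hk (n + 1)).cdf_nonneg hx
      have := (hk (n + 1)).cdf_le hx
      have := h.cdf_nonneg hx
      have := h.cdf_le hx
      rw [abs_le]
      constructor <;> linarith
  · have hz : (x + 1) / 2 ∈ Ioc (0 : ℝ) 1 := ⟨by linarith [hx.1], by linarith [hx.2]⟩
    have h1 : Tendsto (fun n => densityTransfer α p
        (cesaroMean (densityTransfer α p) n f) x)
        (hyperfilter ℕ) (𝓝 (densityTransfer α p g x)) := by
      simp only [densityTransfer_apply]
      exact tendsto_finsetSum _ fun j _ => (((hg _ (lsvInv_mem_Ioc (hα j) hx)).div_const _).add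
        ((hg _ hz).div_const _)).const_mul _
    simp only [apply_cesaroMean] at h1
    refine tendsto_nhds_unique h1 ?_
    have h2 := (hg x hx).add (tendsto_inv_mul_of_bounded hU (C := m / x)
      (u := fun n => (densityTransfer α p ^ (n + 1)) f x - f x) fun n => ?_)
    · rwa [add_zero] at h2
    · have := (hk (n + 1)).nonneg x hx
      have := (hk (n + 1)).density_le hx
      have := h.nonneg x hx
      have := h.density_le hx
      rw [abs_le]
      constructor <;> linarith

end Transfer

section FixedUnique

variable {N : ℕ} {α p : Fin N → ℝ} {β γ m a a' : ℝ} {F f G g : ℝ → ℝ}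

/-- A nonnegative integrable density that is dominated by its image under the transfer operator
is fixed, because the transfer operator preserves the mass. -/
lemma densityTransfer_eq_of_le (hα : ∀ j, 0 < α j) (hp1 : ∑ j, p j = 1) {φ : ℝ → ℝ}
    (hc : ContinuousOn φ (Ioc 0 1)) (hi : IntervalIntegrable φ volume 0 1)
    (hle : ∀ x ∈ Ioo (0 : ℝ) 1, φ x ≤ densityTransfer α p φ x) :
    ∀ x ∈ Ioo (0 : ℝ) 1, densityTransfer α p φ x = φ x := by
  set A : ℝ → ℝ := fun x => ∫ t in (0 : ℝ)..x, φ t with hA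
  have hA0 : A 0 = 0 := by simp [hA]
  have hAc : ContinuousOn A (Icc 0 1) := by
    have := intervalIntegral.continuousOn_primitive_interval' hi left_mem_uIcc
    rwa [uIcc_of_le zero_le_one] at this
  have hAd : ∀ x ∈ Ioo (0 : ℝ) 1, HasDerivAt A (φ x) x := by
    intro x hx
    have hco := hc.mono Ioo_subset_Ioc_self
    refine intervalIntegral.integral_hasDerivAt_right ?_
      (hco.stronglyMeasurableAtFilter isOpen_Ioo x hx) (hco.continuousAt (Ioo_mem_nhds hx.1 hx.2))
    refine hi.mono_set ?_
    rw [uIcc_of_le hx.1.le, uIcc_of_le zero_le_one]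
    exact Icc_subset_Icc_right hx.2.le
  set W : ℝ → ℝ := fun x => cdfTransfer α p A x - A x with hW
  have hmaps : MapsTo (fun x : ℝ => (x + 1) / 2) (Icc 0 1) (Icc 0 1) := fun x hx =>
    ⟨by linarith [hx.1], by linarith [hx.2]⟩
  have hWc : ContinuousOn W (Icc 0 1) := by
    refine ContinuousOn.sub ?_ hAc
    change ContinuousOn
      (fun x => ∑ j, p j * (A (lsvInv (α j) x) + A ((x + 1) / 2) - A (1 / 2))) (Icc 0 1)
    refine continuousOn_finsetSum _ fun j _ => continuousOn_const.mul
      (((hAc.comp (continuousOn_lsvInv (hα j)) fun x hx => lsvInv_mem_Icc (hα j) hx).add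
        (hAc.comp (by fun_prop) hmaps)).sub continuousOn_const)
  have hWd : ∀ x ∈ Ioo (0 : ℝ) 1, HasDerivAt W (densityTransfer α p φ x - φ x) x := by
    intro x hx
    refine HasDerivAt.sub ?_ (hAd x hx)
    have hx' := Ioo_subset_Ioc_self hx
    have : HasDerivAt (fun x => ∑ j, p j * (A (lsvInv (α j) x) + A ((x + 1) / 2) - A (1 / 2)))
        (densityTransfer α p φ x) x := by
      rw [densityTransfer_apply]
      refine HasDerivAt.fun_sum fun j _ => HasDerivAt.const_mul _ (HasDerivAt.sub_const _ ?_)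
      refine HasDerivAt.add ?_ ?_
      · rw [div_eq_mul_inv]
        refine (hAd _ ⟨lsvInv_pos (hα j) hx', ?_⟩).comp x (hasDerivAt_lsvInv (hα j) hx)
        exact (lsvInv_mem (hα j) (Ioc_subset_Icc_self hx')).2.trans_lt (by norm_num)
      · rw [div_eq_mul_inv, ← one_div]
        exact HasDerivAt.comp x (h := fun x : ℝ => (x + 1) / 2)
          (hAd _ ⟨by linarith [hx.1], by linarith [hx.2]⟩)
          (((hasDerivAt_id x).add_const 1).div_const 2)
    exact this
  have hmono : MonotoneOn W (Icc 0 1) := by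
    refine monotoneOn_of_deriv_nonneg (convex_Icc 0 1) hWc ?_ ?_ <;> rw [interior_Icc]
    · exact fun x hx => (hWd x hx).differentiableAt.differentiableWithinAt
    · intro x hx
      rw [(hWd x hx).deriv]
      exact sub_nonneg.2 (hle x hx)
  have hW0 : W 0 = 0 := by simp [hW, cdfTransfer_apply, lsvInv_zero (hα _), hA0]
  have hW1 : W 1 = 0 := by simp [hW, cdfTransfer_apply, lsvInv_one (hα _), ← Finset.sum_mul, hp1]
  have hWz : ∀ x ∈ Icc (0 : ℝ) 1, W x = 0 := fun x hx => le_antisymm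
    (hW1 ▸ hmono hx (by simp) hx.2) (hW0 ▸ hmono (by simp) hx hx.1)
  intro x hx
  have h0 : HasDerivAt W 0 x := by
    refine (hasDerivAt_const x (0 : ℝ)).congr_of_eventuallyEq ?_
    filter_upwards [Icc_mem_nhds hx.1 hx.2] with y hy using hWz y hy
  exact sub_eq_zero.1 ((hWd x hx).unique h0)

/-- A set that is invariant under the inverse branches of an LSV map and relatively closed at
`1/2` is either empty or dense in `(0,1)`. -/
lemma exists_mem_Ioo_of_backward_invariant {α : ℝ} (hα : 0 < α) {Z : Set ℝ} (hZ : Z ⊆ Ioo 0 1)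
    (hne : Z.Nonempty) (hleft : ∀ z ∈ Z, lsvInv α z ∈ Z) (hright : ∀ z ∈ Z, (z + 1) / 2 ∈ Z)
    (hhalf : (∀ ε > 0, ∃ z ∈ Z, 1 / 2 < z ∧ z < 1 / 2 + ε) → 1 / 2 ∈ Z)
    {u v : ℝ} (hu : 0 ≤ u) (huv : u < v) (hv : v ≤ 1) : ∃ z ∈ Z, u < z ∧ z < v := by
  have hacc : ∀ ε > 0, ∃ z ∈ Z, z < ε := by
    by_contra! ⟨ε, hε, hlow⟩
    have hbdd : BddBelow Z := ⟨ε, hlow⟩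
    have hδ : 0 < ε * (2 ^ α * ε ^ α) := by positivity
    obtain ⟨z, hz, hzm⟩ := Real.lt_sInf_add_pos hne hδ
    have h1 := csInf_le hbdd (hleft z hz)
    have h2 := hlow _ (hleft z hz)
    have h0 : 0 ≤ lsvInv α z := hε.le.trans h2
    have h3 := lsvLeft_lsvInv hα (Ioo_subset_Icc_self (hZ hz))
    have h4 : ε * (2 ^ α * ε ^ α) ≤ lsvInv α z * (2 ^ α * lsvInv α z ^ α) := by gcongr
    rw [lsvLeft] at h3
    linarith
  have hhalf' : 1 / 2 ∈ Z := hhalf fun ε hε => by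
    obtain ⟨z, hz, hzε⟩ := hacc ε hε
    exact ⟨_, hright z hz, by linarith [(hZ hz).1], by linarith [(hZ hz).1]⟩
  by_contra! hgap
  set P : Set (ℝ × ℝ) := (Icc 0 1 ×ˢ Icc 0 1) ∩ ⋂ z ∈ Z, {q | z ≤ q.1 ∨ q.2 ≤ z} with hP
  have hPc : IsCompact P := by
    refine (isCompact_Icc.prod isCompact_Icc).inter_right (isClosed_biInter fun z _ => ?_)
    exact (isClosed_le continuous_const continuous_fst).union
      (isClosed_le continuous_snd continuous_const)
  have huvP : (u, v) ∈ P := by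
    refine ⟨⟨⟨hu, by linarith⟩, ⟨by linarith, hv⟩⟩, mem_iInter₂.2 fun z hz => ?_⟩
    rcases le_or_gt z u with h | h
    · exact Or.inl h
    · exact Or.inr (hgap z hz h)
  obtain ⟨⟨s, t⟩, ⟨⟨hs, ht⟩, hst⟩, hmax⟩ := hPc.exists_isMaxOn ⟨_, huvP⟩
    (f := fun q : ℝ × ℝ => q.2 - q.1) (by fun_prop)
  have hlen : v - u ≤ t - s := hmax huvP
  have hst' : ∀ z ∈ Z, z ≤ s ∨ t ≤ z := fun z hz => mem_iInter₂.1 hst z hz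
  simp only at hs ht
  rcases hst' _ hhalf' with h | h
  · have hmem : (2 * s - 1, 2 * t - 1) ∈ P := by
      refine ⟨⟨⟨by simp; linarith, by simp; linarith [hs.2]⟩,
        ⟨by simp; linarith, by simp; linarith [ht.2]⟩⟩, mem_iInter₂.2 fun z hz => ?_⟩
      rcases hst' _ (hright z hz) with h | h
      · exact Or.inl (by simp only; linarith)
      · exact Or.inr (by simp only; linarith)
    have : (2 * t - 1) - (2 * s - 1) ≤ t - s := hmax hmem
    linarith
  · have hlt := sub_lt_lsvLeft_sub hα hs.1 (show s < t by linarith)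
    have hmono := (lsvLeft_strictMonoOn hα).monotoneOn
    have h1 : ∀ w ∈ Icc (0 : ℝ) (1 / 2), lsvLeft α w ∈ Icc (0 : ℝ) 1 := fun w hw => by
      have h1 := hmono self_mem_Ici hw.1 hw.1
      have h2 := hmono hw.1 (show (0 : ℝ) ≤ 1 / 2 by norm_num) hw.2
      rw [lsvLeft_zero] at h1
      rw [lsvLeft_half] at h2
      exact ⟨h1, h2⟩
    have hmem : (lsvLeft α s, lsvLeft α t) ∈ P := by
      refine ⟨⟨h1 s ⟨hs.1, by linarith⟩, h1 t ⟨ht.1, h⟩⟩, mem_iInter₂.2 fun z hz => ?_⟩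
      have hz' := Ioo_subset_Icc_self (hZ hz)
      have hzi := (lsvInv_mem hα hz').1
      rcases hst' _ (hleft z hz) with h | h
      · refine Or.inl ?_
        have := hmono hzi hs.1 h
        rwa [lsvLeft_lsvInv hα hz'] at this
      · exact Or.inr ((lsvInv_le_iff hα hz' ht.1).1 h)
    have : lsvLeft α t - lsvLeft α s ≤ t - s := hmax hmem
    linarith

lemma IsLsvCone.fixed_unique (hα : ∀ j, 0 < α j) (hp : ∀ j, 0 < p j) (hp1 : ∑ j, p j = 1)
    (i : Fin N) (hγ : γ < 1) (hF : IsLsvCone β γ m a F f) (hG : IsLsvCone β γ m a' G g)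
    (hf : ∀ x ∈ Ioc (0 : ℝ) 1, densityTransfer α p f x = f x)
    (hg : ∀ x ∈ Ioc (0 : ℝ) 1, densityTransfer α p g x = g x) :
    ∀ x ∈ Icc (0 : ℝ) 1, F x = G x := by
  have hFc := hF.cdf_continuousOn hγ hF.bound
  have hGc := hG.cdf_continuousOn hγ hG.bound
  have hfc := hF.continuousOn.sub hG.continuousOn
  have hterm : ∀ (x : ℝ) (j : Fin N), x ∈ Ioc (0 : ℝ) 1 →
      0 < lsvSlope (α j) (lsvInv (α j) x) := fun x j hx =>
    zero_lt_one.trans_le (one_le_lsvSlope (hα j) (lsvInv_pos (hα j) hx).le)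
  set φ : ℝ → ℝ := fun x => |f x - g x| with hφ
  have hfix : ∀ x ∈ Ioo (0 : ℝ) 1, densityTransfer α p φ x = φ x := by
    refine densityTransfer_eq_of_le hα hp1 hfc.abs
      ((hF.intervalIntegrable hγ hF.bound).sub (hG.intervalIntegrable hγ hG.bound)).abs
      fun x hx => ?_
    have hx' := Ioo_subset_Ioc_self hx
    have e : f x - g x = densityTransfer α p (f - g) x := by
      rw [map_sub, Pi.sub_apply, hf x hx', hg x hx']
    rw [hφ]
    simp only
    rw [e, densityTransfer_apply, densityTransfer_apply]
    refine (Finset.abs_sum_le_sum_abs _ _).trans (Finset.sum_le_sum fun j _ => ?_)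
    rw [abs_mul, abs_of_pos (hp j)]
    refine mul_le_mul_of_nonneg_left ((abs_add_le _ _).trans_eq ?_) (hp j).le
    rw [abs_div, abs_div, abs_of_pos (hterm x j hx'), abs_of_pos (zero_lt_two (α := ℝ))]
    rfl
  set Z : Set ℝ := {x ∈ Ioo (0 : ℝ) 1 | φ x = 0} with hZ
  have hzero : ∀ z ∈ Z, φ (lsvInv (α i) z) = 0 ∧ φ ((z + 1) / 2) = 0 := by
    rintro z ⟨hz, hz0⟩
    have hnn : ∀ x, 0 ≤ φ x := fun x => abs_nonneg _
    have h := hfix z hz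
    have hs : ∀ j, 0 < lsvSlope (α j) (lsvInv (α j) z) :=
      fun j => hterm z j (Ioo_subset_Ioc_self hz)
    have hnn1 : ∀ j, 0 ≤ φ (lsvInv (α j) z) / lsvSlope (α j) (lsvInv (α j) z) :=
      fun j => div_nonneg (hnn _) (hs j).le
    have hnn2 := hnn ((z + 1) / 2)
    rw [hz0, densityTransfer_apply, Finset.sum_eq_zero_iff_of_nonneg fun j _ =>
      mul_nonneg (hp j).le (add_nonneg (hnn1 j) (by positivity))] at h
    have h1 := (mul_eq_zero.1 (h i (Finset.mem_univ i))).resolve_left (hp i).ne'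
    have h2 := hnn1 i
    refine ⟨?_, by linarith⟩
    exact (div_eq_zero_iff.1 (show φ (lsvInv (α i) z) / lsvSlope (α i) (lsvInv (α i) z) = 0
      by linarith)).resolve_right (hs i).ne'
  have hne : Z.Nonempty := by
    obtain ⟨c, hc, hc0⟩ := exists_hasDerivAt_eq_zero (f := fun x => F x - G x)
      (f' := fun x => f x - g x) zero_lt_one (hFc.sub hGc)
      (by simp [hF.zero, hG.zero, hF.one, hG.one])
      (fun x hx => (hF.hasDerivAt hx).sub (hG.hasDerivAt hx))
    exact ⟨c, hc, by simp [hφ, hc0]⟩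
  have hφc : ∀ x ∈ Ioo (0 : ℝ) 1, ContinuousAt φ x := fun x hx =>
    (hfc.abs).continuousAt (Ioc_mem_nhds hx.1 hx.2)
  have hdense : ∀ {u v : ℝ}, 0 ≤ u → u < v → v ≤ 1 → ∃ z ∈ Z, u < z ∧ z < v := by
    intro u v hu huv hv
    refine exists_mem_Ioo_of_backward_invariant (hα i) (fun z hz => hz.1) hne
      (fun z hz => ⟨⟨lsvInv_pos (hα i) (Ioo_subset_Ioc_self hz.1), ?_⟩, (hzero z hz).1⟩)
      (fun z hz => ⟨⟨by linarith [hz.1.1], by linarith [hz.1.2]⟩, (hzero z hz).2⟩)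
      (fun h => ⟨by norm_num, ?_⟩) hu huv hv
    · exact (lsvInv_mem (hα i) (Ioo_subset_Icc_self hz.1)).2.trans_lt (by norm_num)
    · by_contra hne0
      obtain ⟨ε, hε, hball⟩ := Metric.eventually_nhds_iff.1
        ((hφc (1 / 2) (by norm_num)).eventually_ne hne0)
      obtain ⟨z, hz, hz1, hz2⟩ := h ε hε
      refine hball ?_ hz.2
      rw [Real.dist_eq, abs_lt]
      constructor <;> linarith
  have hall : ∀ x ∈ Ioo (0 : ℝ) 1, f x - g x = 0 := by
    intro x hx
    by_contra hne0
    obtain ⟨ε, hε, hball⟩ := Metric.eventually_nhds_iff.1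
      ((hφc x hx).eventually_ne (abs_ne_zero.2 hne0))
    obtain ⟨z, hz, hz1, hz2⟩ := hdense (u := x) (v := min (x + ε) 1) hx.1.le
      (lt_min (by linarith) hx.2) (min_le_right _ _)
    refine hball ?_ hz.2
    have := min_le_left (x + ε) 1
    rw [Real.dist_eq, abs_lt]
    constructor <;> linarith
  intro x hx
  rw [← hF.integral_eq hγ hF.bound hx, ← hG.integral_eq hγ hG.bound hx]
  refine intervalIntegral.integral_congr_ae ?_
  have h1 : ∀ᵐ t : ℝ, t ≠ 1 := by simp [ae_iff]
  filter_upwards [h1] with t ht1 ht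
  rw [uIoc_of_le hx.1] at ht
  exact sub_eq_zero.1 (hall t ⟨ht.1, lt_of_le_of_ne (ht.2.trans hx.2) ht1⟩)

end FixedUnique

section CesaroLimit

variable {N : ℕ} {α p : Fin N → ℝ} {β γ m a : ℝ} {F f : ℝ → ℝ}

lemma IsLsvCone.tendsto_cesaro (hα : ∀ j, 0 < α j) (hp : ∀ j, 0 < p j) (hp1 : ∑ j, p j = 1)
    (hβ : ∀ j, α j ≤ β) (i : Fin N) (hi : α i < 1) {F₀ f₀ : ℝ → ℝ} {a₀ : ℝ}
    (h₀ : IsLsvCone β (α i) 1 a₀ F₀ f₀)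
    (hf₀ : ∀ x ∈ Ioc (0 : ℝ) 1, densityTransfer α p f₀ x = f₀ x)
    (h : IsLsvCone β (α i) m a F f) {x : ℝ} (hx : x ∈ Icc (0 : ℝ) 1) :
    Tendsto (fun n => cesaroMean (cdfTransfer α p) n F x) (hyperfilter ℕ) (𝓝 (m * F₀ x)) := by
  have hκ : 0 < p i * ((1 - α i) / 2) := mul_pos (hp i) (by linarith)
  have hm : 0 ≤ m := by simpa [h.one] using h.cdf_nonneg (x := 1) (by simp)
  obtain ⟨G, g, hG, hlim, -, hg⟩ :=
    (h.mono_bound (le_max_left a (m / (p i * ((1 - α i) / 2))))).exists_fixed hα hp hp1 hβ i hi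
      (by
        rw [← div_le_iff₀' hκ]
        exact le_max_right _ _)
  have h₁ := h₀.smul hm
  rw [mul_one] at h₁
  have := hG.fixed_unique hα hp hp1 i hi h₁ hg (fun x hx => by
    rw [map_smul, Pi.smul_apply, Pi.smul_apply, hf₀ x hx]) x hx
  have h2 := hlim x hx
  rwa [this] at h2

lemma cesaroMean_mem_Icc (hα : ∀ j, 0 < α j) (hp : ∀ j, 0 < p j) (hp1 : ∑ j, p j = 1)
    {G : ℝ → ℝ} {ε : ℝ} (hm : MonotoneOn G (Icc 0 1)) (h0 : G 0 = 0) (h1 : G 1 ≤ ε) (n : ℕ)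
    {x : ℝ} (hx : x ∈ Icc (0 : ℝ) 1) : cesaroMean (cdfTransfer α p) n G x ∈ Icc 0 ε := by
  have hpow : ∀ k : ℕ, MonotoneOn ((cdfTransfer α p ^ k) G) (Icc 0 1) ∧
      (cdfTransfer α p ^ k) G 0 = 0 ∧ (cdfTransfer α p ^ k) G 1 ≤ ε := by
    intro k
    induction k with
    | zero => exact ⟨hm, h0, h1⟩
    | succ k ih =>
      rw [pow_succ', Module.End.mul_apply]
      obtain ⟨ihm, ih0, ih1⟩ := ih
      refine ⟨fun x hx y hy hxy => ?_, ?_, ?_⟩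
      · rw [cdfTransfer_apply, cdfTransfer_apply]
        refine Finset.sum_le_sum fun j _ => mul_le_mul_of_nonneg_left ?_ (hp j).le
        have h1 := ihm (lsvInv_mem_Icc (hα j) hx) (lsvInv_mem_Icc (hα j) hy)
          (lsvInv_mono (hα j) hx hy hxy)
        have h2 := ihm (show (x + 1) / 2 ∈ Icc (0 : ℝ) 1 from
          ⟨by linarith [hx.1], by linarith [hx.2]⟩) (show (y + 1) / 2 ∈ Icc (0 : ℝ) 1 from
          ⟨by linarith [hy.1], by linarith [hy.2]⟩) (by linarith)
        linarith
      · simp [cdfTransfer_apply, lsvInv_zero (hα _), ih0]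
      · simpa [cdfTransfer_apply, lsvInv_one (hα _), ← Finset.sum_mul, hp1] using ih1
  have hmem : ∀ k, (cdfTransfer α p ^ k) G x ∈ Icc 0 ε := fun k => by
    obtain ⟨hkm, hk0, hk1⟩ := hpow k
    exact ⟨hk0 ▸ hkm (by simp) hx hx.1, (hkm hx (by simp) hx.2).trans hk1⟩
  rw [cesaroMean_apply, Pi.smul_apply, Finset.sum_apply, smul_eq_mul]
  have hn : (0 : ℝ) < (n : ℝ) + 1 := by positivity
  refine ⟨mul_nonneg (by positivity) (Finset.sum_nonneg fun k _ => (hmem k).1), ?_⟩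
  rw [inv_mul_le_iff₀ hn]
  have := Finset.sum_le_card_nsmul (Finset.range (n + 1)) _ ε fun k _ => (hmem k).2
  rw [Finset.card_range, nsmul_eq_mul] at this
  push_cast at this
  exact this

lemma cesaroMean_eq_self (hα : ∀ j, 0 < α j) {H : ℝ → ℝ}
    (hH : ∀ x ∈ Icc (0 : ℝ) 1, cdfTransfer α p H x = H x) (n : ℕ) {x : ℝ}
    (hx : x ∈ Icc (0 : ℝ) 1) : cesaroMean (cdfTransfer α p) n H x = H x := by
  have hpow : ∀ k : ℕ, ∀ x ∈ Icc (0 : ℝ) 1, (cdfTransfer α p ^ k) H x = H x := by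
    intro k
    induction k with
    | zero => exact fun x _ => rfl
    | succ k ih =>
      intro x hx
      rw [pow_succ', Module.End.mul_apply, ← hH x hx, cdfTransfer_apply, cdfTransfer_apply]
      refine Finset.sum_congr rfl fun j _ => ?_
      rw [ih _ (lsvInv_mem_Icc (hα j) hx), ih ((x + 1) / 2)
        ⟨by linarith [hx.1], by linarith [hx.2]⟩, ih (1 / 2) (by norm_num)]
  rw [cesaroMean_apply, Pi.smul_apply, Finset.sum_apply, smul_eq_mul,
    Finset.sum_congr rfl fun k _ => hpow k x hx, Finset.sum_const, Finset.card_range, nsmul_eq_mul]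
  push_cast
  exact inv_mul_cancel_left₀ (by positivity) _

/-- A Lipschitz function becomes an admissible density after adding a steep affine function. -/
lemma isLsvCone_of_lipschitz (hβ : 0 ≤ β) (hγ : 0 < γ) {ψ : ℝ → ℝ} {M : ℝ} (hM : 0 ≤ M)
    (hc : Continuous ψ) (hb : ∀ x ∈ Icc (0 : ℝ) 1, |ψ x| ≤ M)
    (hl : ∀ x ∈ Icc (0 : ℝ) 1, ∀ y ∈ Icc (0 : ℝ) 1, x ≤ y → |ψ y - ψ x| ≤ M * (y - x)) :
    IsLsvCone β γ (∫ t in (0 : ℝ)..1, (ψ t + 2 * M * (3 - t))) (7 * M)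
      (fun x => ∫ t in (0 : ℝ)..x, (ψ t + 2 * M * (3 - t)))
      (fun x => ψ x + 2 * M * (3 - x)) := by
  have hnn : ∀ x ∈ Ioc (0 : ℝ) 1, 0 ≤ ψ x + 2 * M * (3 - x) := fun x hx => by
    have := (abs_le.1 (hb x (Ioc_subset_Icc_self hx))).1
    nlinarith [hx.2]
  refine .of_continuous (by fun_prop) hnn (fun x hx y hy hxy => ?_) (fun x hx y hy hxy => ?_) hγ
    (by positivity) (fun x hx => ?_)
  · have := (abs_le.1 (hl x (Ioc_subset_Icc_self hx) y (Ioc_subset_Icc_self hy) hxy)).2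
    nlinarith
  · have h1 := (abs_le.1 (hl x (Ioc_subset_Icc_self hx) y (Ioc_subset_Icc_self hy) hxy)).1
    have h2 := (abs_le.1 (hb y (Ioc_subset_Icc_self hy))).1
    have h3 : x * (ψ x + 2 * M * (3 - x)) ≤ y * (ψ y + 2 * M * (3 - y)) := by
      have h4 : x * (-(M * (y - x))) ≤ x * (ψ y - ψ x) := mul_le_mul_of_nonneg_left h1 hx.1.le
      have h5 : (y - x) * -M ≤ (y - x) * ψ y := mul_le_mul_of_nonneg_left h2 (by linarith)
      have h6 : 0 ≤ M * (y - x) := mul_nonneg hM (by linarith)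
      have h7 : x * (M * (y - x)) ≤ M * (y - x) := mul_le_of_le_one_left h6 hx.2
      have h8 : M * (y - x) * 1 ≤ M * (y - x) * (3 - x - y) :=
        mul_le_mul_of_nonneg_left (by linarith [hx.2, hy.2]) h6
      nlinarith
    have h4 : x ^ β ≤ y ^ β := Real.rpow_le_rpow hx.1.le hxy hβ
    simp only
    rw [add_comm 1 β, Real.rpow_add_one hx.1.ne', Real.rpow_add_one hy.1.ne',
      mul_assoc (x ^ β), mul_assoc (y ^ β)]
    exact mul_le_mul h4 h3 (mul_nonneg hx.1.le (hnn x hx)) (Real.rpow_nonneg hy.1.le _)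
  · have := (abs_le.1 (hb x (Ioc_subset_Icc_self hx))).2
    nlinarith [hx.1]

lemma exists_lipschitz_bound_polynomial (q : Polynomial ℝ) :
    ∃ M, 0 ≤ M ∧ (∀ x ∈ Icc (0 : ℝ) 1, |q.eval x| ≤ M) ∧
      ∀ x ∈ Icc (0 : ℝ) 1, ∀ y ∈ Icc (0 : ℝ) 1, x ≤ y →
        |q.eval y - q.eval x| ≤ M * (y - x) := by
  obtain ⟨M₁, h₁⟩ := isCompact_Icc.exists_bound_of_continuousOn (s := Icc (0 : ℝ) 1)
    q.continuous.continuousOn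
  obtain ⟨M₂, h₂⟩ := isCompact_Icc.exists_bound_of_continuousOn (s := Icc (0 : ℝ) 1)
    q.derivative.continuous.continuousOn
  refine ⟨max M₁ M₂, ((abs_nonneg _).trans (h₁ 0 (by simp))).trans (le_max_left _ _),
    fun x hx => (h₁ x hx).trans (le_max_left _ _), fun x hx y hy hxy => ?_⟩
  have := (convex_Icc (0 : ℝ) 1).norm_image_sub_le_of_norm_hasDerivWithin_le
    (f := fun x => q.eval x) (f' := fun x => q.derivative.eval x)
    (fun x _ => (q.hasDerivAt x).hasDerivWithinAt)
    (fun x hx => (h₂ x hx).trans (le_max_right M₁ M₂)) hx hy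
  rwa [Real.norm_eq_abs, Real.norm_eq_abs, abs_of_nonneg (sub_nonneg.2 hxy)] at this

/-- A stationary absolutely continuous distribution function agrees with that of any fixed
element of the cone. -/
lemma eq_of_fixed_primitive (hα : ∀ j, 0 < α j) (hp : ∀ j, 0 < p j) (hp1 : ∑ j, p j = 1)
    (hβ : ∀ j, α j ≤ β) (i : Fin N) (hi : α i < 1) {F₀ f₀ : ℝ → ℝ} {a₀ : ℝ}
    (h₀ : IsLsvCone β (α i) 1 a₀ F₀ f₀)
    (hf₀ : ∀ x ∈ Ioc (0 : ℝ) 1, densityTransfer α p f₀ x = f₀ x) {h : ℝ → ℝ}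
    (hh : Integrable h) (hH1 : ∫ t in (0 : ℝ)..1, h t = 1)
    (hH : ∀ x ∈ Icc (0 : ℝ) 1, cdfTransfer α p (fun x => ∫ t in (0 : ℝ)..x, h t) x =
      ∫ t in (0 : ℝ)..x, h t) {x : ℝ} (hx : x ∈ Icc (0 : ℝ) 1) :
    ∫ t in (0 : ℝ)..x, h t = F₀ x := by
  refine eq_of_forall_dist_le fun ε hε => ?_
  obtain ⟨φ, -, hφ, hφc, hφi⟩ := hh.exists_hasCompactSupport_integral_sub_le
    (show 0 < ε / 12 by positivity)
  obtain ⟨q, hq⟩ := exists_polynomial_near_of_continuousOn 0 1 φ hφc.continuousOn (ε / 12)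
    (by positivity)
  obtain ⟨M, hM, hqb, hql⟩ := exists_lipschitz_bound_polynomial q
  have hβ0 : 0 ≤ β := (hα i).le.trans (hβ i)
  have hqc : Continuous fun x => q.eval x := q.continuous
  have hC1 := isLsvCone_of_lipschitz hβ0 (hα i) hM hqc hqb hql
  have hC2 := isLsvCone_of_lipschitz (ψ := fun _ => 0) hβ0 (hα i) hM continuous_const
    (fun x hx => by simpa using hM)
    (fun x hx y hy hxy => by simpa using mul_nonneg hM (sub_nonneg.2 hxy))
  set m₁ := ∫ t in (0 : ℝ)..1, (q.eval t + 2 * M * (3 - t))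
  set Ψ₁ : ℝ → ℝ := fun x => ∫ t in (0 : ℝ)..x, (q.eval t + 2 * M * (3 - t))
  set m₂ := ∫ t in (0 : ℝ)..1, (0 + 2 * M * (3 - t))
  set Ψ₂ : ℝ → ℝ := fun x => ∫ t in (0 : ℝ)..x, (0 + 2 * M * (3 - t))
  set r : ℝ → ℝ := fun t => h t - q.eval t
  have hhi : ∀ u v : ℝ, IntervalIntegrable h volume u v := fun u v => hh.intervalIntegrable
  have hri : ∀ u v : ℝ, IntervalIntegrable r volume u v := fun u v =>
    (hhi u v).sub (hqc.intervalIntegrable _ _)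
  set R₁ : ℝ → ℝ := fun x => ∫ t in (0 : ℝ)..x, |r t|
  set R₂ : ℝ → ℝ := fun x => ∫ t in (0 : ℝ)..x, (|r t| - r t)
  have hdec : (fun x => ∫ t in (0 : ℝ)..x, h t) = Ψ₁ - Ψ₂ + (R₁ - R₂) := by
    ext y
    simp only [Ψ₁, Ψ₂, R₁, R₂, Pi.add_apply, Pi.sub_apply]
    rw [← intervalIntegral.integral_sub (Continuous.intervalIntegrable (by fun_prop) _ _)
      (Continuous.intervalIntegrable (by fun_prop) _ _),
      ← intervalIntegral.integral_sub (hri _ _).abs ((hri _ _).abs.sub (hri _ _)),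
      ← intervalIntegral.integral_add]
    · exact intervalIntegral.integral_congr fun t _ => by simp only [r]; ring
    · exact Continuous.intervalIntegrable (by fun_prop) _ _
    · exact (hri _ _).abs.sub ((hri _ _).abs.sub (hri _ _))
  have hmon : ∀ φ : ℝ → ℝ, (∀ u v : ℝ, IntervalIntegrable φ volume u v) → (∀ t, 0 ≤ φ t) →
      MonotoneOn (fun x => ∫ t in (0 : ℝ)..x, φ t) (Icc 0 1) := by
    intro φ hφ hnn x _ y _ hxy
    have := intervalIntegral.integral_nonneg (μ := volume) hxy fun t _ => hnn t
    rw [← intervalIntegral.integral_interval_sub_left (hφ 0 y) (hφ 0 x)] at this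
    simp only
    linarith
  have hR₁m : MonotoneOn R₁ (Icc 0 1) := hmon _ (fun u v => (hri u v).abs) fun t => abs_nonneg _
  have hR₂m : MonotoneOn R₂ (Icc 0 1) := hmon _ (fun u v => (hri u v).abs.sub (hri u v))
    fun t => sub_nonneg.2 (le_abs_self _)
  have hR₁1 : R₁ 1 ≤ ε / 6 := by
    have hd : Integrable (fun t => ‖h t - φ t‖) := (hh.sub hφi).norm
    have e1 : R₁ 1 ≤ ∫ t in (0 : ℝ)..1, (‖h t - φ t‖ + ε / 12) := by
      refine intervalIntegral.integral_mono_on zero_le_one (hri _ _).abs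
        (hd.intervalIntegrable.add (by simp)) fun t ht => ?_
      have h1 := hq t ht
      have h2 := abs_sub_le (h t) (φ t) (q.eval t)
      rw [abs_sub_comm (φ t)] at h2
      rw [Real.norm_eq_abs]
      linarith
    rw [intervalIntegral.integral_add hd.intervalIntegrable (by simp)] at e1
    have e2 : ∫ t in (0 : ℝ)..1, ‖h t - φ t‖ ≤ ∫ t, ‖h t - φ t‖ := by
      rw [intervalIntegral.integral_of_le zero_le_one]
      exact setIntegral_le_integral hd (Filter.Eventually.of_forall fun t => norm_nonneg _)
    simp at e1
    simp only [Real.norm_eq_abs] at *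
    linarith
  have hR₂1 : R₂ 1 ≤ ε / 3 := by
    have : R₂ 1 ≤ ∫ t in (0 : ℝ)..1, 2 * |r t| := by
      refine intervalIntegral.integral_mono_on zero_le_one ((hri _ _).abs.sub (hri _ _))
        ((hri _ _).abs.const_mul 2) fun t ht => ?_
      have := neg_le_abs (r t)
      linarith
    rw [intervalIntegral.integral_const_mul] at this
    have h1 : R₁ 1 = ∫ t in (0 : ℝ)..1, |r t| := rfl
    linarith
  have hR₁0 : R₁ 0 = 0 := by simp [R₁]
  have hR₂0 : R₂ 0 = 0 := by simp [R₂]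
  have hlim := (IsLsvCone.tendsto_cesaro hα hp hp1 hβ i hi h₀ hf₀ hC1 hx).sub
    (IsLsvCone.tendsto_cesaro hα hp hp1 hβ i hi h₀ hf₀ hC2 hx)
  have hclose : ∀ n : ℕ, cesaroMean (cdfTransfer α p) n Ψ₁ x - cesaroMean (cdfTransfer α p) n Ψ₂ x ∈
      Icc ((∫ t in (0 : ℝ)..x, h t) - ε / 3) ((∫ t in (0 : ℝ)..x, h t) + ε / 3) := by
    intro n
    have h1 := cesaroMean_eq_self hα hH n hx
    rw [hdec, map_add, map_sub, map_sub] at h1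
    simp only [Pi.add_apply, Pi.sub_apply] at h1
    have h2 := cesaroMean_mem_Icc hα hp hp1 hR₁m hR₁0 hR₁1 n hx
    have h3 := cesaroMean_mem_Icc hα hp hp1 hR₂m hR₂0 hR₂1 n hx
    constructor <;> linarith [h2.1, h2.2, h3.1, h3.2]
  have hmem := isClosed_Icc.mem_of_tendsto hlim (Filter.Eventually.of_forall hclose)
  have hmass : (∫ t in (0 : ℝ)..1, h t) = m₁ - m₂ + (R₁ 1 - R₂ 1) := congrFun hdec 1
  rw [hH1] at hmass
  have hR₁p := hR₁0 ▸ hR₁m (by simp) (right_mem_Icc.2 zero_le_one) zero_le_one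
  have hR₂p := hR₂0 ▸ hR₂m (by simp) (right_mem_Icc.2 zero_le_one) zero_le_one
  have hF0 := h₀.cdf_nonneg hx
  have hF1 := h₀.cdf_le hx
  have e : m₁ * F₀ x - m₂ * F₀ x = F₀ x - (R₁ 1 - R₂ 1) * F₀ x := by
    rw [← sub_mul, show m₁ - m₂ = 1 - (R₁ 1 - R₂ 1) by linarith]
    ring
  rw [e] at hmem
  have hs : |(R₁ 1 - R₂ 1) * F₀ x| ≤ ε / 3 := by
    rw [abs_mul, abs_of_nonneg hF0]
    have : |R₁ 1 - R₂ 1| ≤ ε / 3 := by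
      rw [abs_le]; constructor <;> linarith
    nlinarith [abs_nonneg (R₁ 1 - R₂ 1)]
  rw [abs_le] at hs
  rw [Real.dist_eq, abs_le]
  constructor <;> linarith [hmem.1, hmem.2]

end CesaroLimit

section CumulativeMass

lemma lsvMap_of_le {α x : ℝ} (hx : x ≤ 1 / 2) : lsvMap α x = lsvLeft α x := if_pos hx

lemma lsvMap_of_lt {α x : ℝ} (hx : 1 / 2 < x) : lsvMap α x = 2 * x - 1 := if_neg hx.not_ge

lemma measurable_lsvMap (α : ℝ) : Measurable (lsvMap α) := by
  unfold lsvMap lsvLeft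
  exact Measurable.ite measurableSet_Iic (by fun_prop) (by fun_prop)

lemma lsvMap_mem_Icc {α x : ℝ} (hα : 0 < α) (hx : x ∈ Icc (0 : ℝ) 1) :
    lsvMap α x ∈ Icc (0 : ℝ) 1 := by
  rcases le_or_gt x (1 / 2) with h | h
  · rw [lsvMap_of_le h]
    have hmono := (lsvLeft_strictMonoOn hα).monotoneOn
    have h1 := hmono (show (0 : ℝ) ∈ Ici 0 from self_mem_Ici) hx.1 hx.1
    have h2 := hmono hx.1 (show (1 / 2 : ℝ) ∈ Ici 0 by norm_num [mem_Ici]) h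
    rw [lsvLeft_zero] at h1
    rw [lsvLeft_half] at h2
    exact ⟨h1, h2⟩
  · rw [lsvMap_of_lt h]
    exact ⟨by linarith, by linarith [hx.2]⟩

lemma lsvMap_preimage_Iic_inter {α x : ℝ} (hα : 0 < α) (hx : x ∈ Icc (0 : ℝ) 1) :
    lsvMap α ⁻¹' Iic x ∩ Icc 0 1 =
      (Iic (lsvInv α x) ∪ Ioc (1 / 2) ((x + 1) / 2)) ∩ Icc 0 1 := by
  have hm := lsvInv_mem hα hx
  ext t
  simp only [mem_inter_iff, mem_preimage, mem_Iic, mem_union, mem_Ioc, and_congr_left_iff]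
  intro ht
  rcases le_or_gt t (1 / 2) with h | h
  · rw [lsvMap_of_le h, ← lsvInv_le_iff hα hx ht.1]
    exact ⟨Or.inl, fun hor => hor.resolve_right fun hI => h.not_gt hI.1⟩
  · rw [lsvMap_of_lt h]
    constructor
    · exact fun h' => Or.inr ⟨h, by linarith⟩
    · rintro (h' | h')
      · linarith [hm.2]
      · linarith [h'.2]

lemma measureReal_lsvMap_preimage_Iic {μ : Measure ℝ} [IsFiniteMeasure μ]
    (hμ : ∀ᵐ t ∂μ, t ∈ Icc (0 : ℝ) 1) {α x : ℝ} (hα : 0 < α) (hx : x ∈ Icc (0 : ℝ) 1) :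
    μ.real (lsvMap α ⁻¹' Iic x) =
      μ.real (Iic (lsvInv α x)) + μ.real (Iic ((x + 1) / 2)) - μ.real (Iic (1 / 2)) := by
  have hm := lsvInv_mem hα hx
  have h1 : μ.real (lsvMap α ⁻¹' Iic x) =
      μ.real (Iic (lsvInv α x) ∪ Ioc (1 / 2) ((x + 1) / 2)) := by
    refine measureReal_congr ?_
    filter_upwards [hμ] with t ht
    have := congrArg (fun s => t ∈ s) (lsvMap_preimage_Iic_inter hα hx)
    simp only [mem_inter_iff, ht, and_true] at this
    exact this
  have hd : Disjoint (Iic (lsvInv α x)) (Ioc (1 / 2) ((x + 1) / 2)) :=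
    Set.disjoint_left.2 fun t ht ht' => by linarith [mem_Iic.1 ht, ht'.1, hm.2]
  rw [h1, measureReal_union hd measurableSet_Ioc, ← Iic_sdiff_Iic,
    measureReal_sdiff (Iic_subset_Iic.2 (by linarith [hx.1])) measurableSet_Iic]
  ring

lemma sum_mul_measureReal_lsvMap_preimage {μ : Measure ℝ} [IsFiniteMeasure μ]
    {N : ℕ} {α p : Fin N → ℝ} (hα : ∀ j, 0 < α j)
    (hμ : ∀ᵐ t ∂μ, t ∈ Icc (0 : ℝ) 1) {x : ℝ} (hx : x ∈ Icc (0 : ℝ) 1) :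
    ∑ j, p j * μ.real (lsvMap (α j) ⁻¹' Iic x) = cdfTransfer α p (fun x => μ.real (Iic x)) x := by
  rw [cdfTransfer_apply]
  exact Finset.sum_congr rfl fun j _ => by rw [measureReal_lsvMap_preimage_Iic hμ (hα j) hx]

lemma ae_mem_Icc_of_absolutelyContinuous {μ : Measure ℝ} (h : μ ≪ volume.restrict (Icc (0 : ℝ) 1)) :
    ∀ᵐ t ∂μ, t ∈ Icc (0 : ℝ) 1 :=
  h.ae_le (ae_restrict_mem measurableSet_Icc)

lemma measure_lsvMap_preimage_inter {μ : Measure ℝ} (hμ : ∀ᵐ t ∂μ, t ∈ Icc (0 : ℝ) 1)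
    {α : ℝ} (hα : 0 < α) (A : Set ℝ) : μ (lsvMap α ⁻¹' (A ∩ Icc 0 1)) = μ (lsvMap α ⁻¹' A) := by
  refine measure_congr ?_
  filter_upwards [hμ] with t ht
  have : lsvMap α t ∈ Icc (0 : ℝ) 1 := lsvMap_mem_Icc hα ht
  exact propext ⟨fun h => h.1, fun h => ⟨h, this⟩⟩

lemma toReal_sum_ofReal_mul {μ : Measure ℝ} [IsFiniteMeasure μ] {N : ℕ} {p : Fin N → ℝ}
    (hp : ∀ j, 0 < p j) (A : Fin N → Set ℝ) :
    (∑ j, ENNReal.ofReal (p j) * μ (A j)).toReal = ∑ j, p j * μ.real (A j) := by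
  rw [ENNReal.toReal_sum fun j _ => ENNReal.mul_ne_top ENNReal.ofReal_ne_top (measure_ne_top μ _)]
  exact Finset.sum_congr rfl fun j _ => by
    rw [ENNReal.toReal_mul, ENNReal.toReal_ofReal (hp j).le, Measure.real]

/-- A stationary measure has a distribution function fixed by the transfer operator. -/
lemma cdfTransfer_eq_of_stationary {μ : Measure ℝ} [IsFiniteMeasure μ] {N : ℕ}
    {α p : Fin N → ℝ} (hα : ∀ j, 0 < α j)
    (hp : ∀ j, 0 < p j) (hμ : ∀ᵐ t ∂μ, t ∈ Icc (0 : ℝ) 1)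
    (hs : ∀ A : Set ℝ, MeasurableSet A → A ⊆ Icc (0 : ℝ) 1 →
      ∑ j, ENNReal.ofReal (p j) * μ (lsvMap (α j) ⁻¹' A) = μ A)
    {x : ℝ} (hx : x ∈ Icc (0 : ℝ) 1) :
    cdfTransfer α p (fun x => μ.real (Iic x)) x = μ.real (Iic x) := by
  rw [← sum_mul_measureReal_lsvMap_preimage hα hμ hx, ← toReal_sum_ofReal_mul hp]
  have h := hs (Iic x ∩ Icc 0 1) (measurableSet_Iic.inter measurableSet_Icc) inter_subset_right
  simp only [measure_lsvMap_preimage_inter hμ (hα _)] at h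
  rw [h, Measure.real, measure_inter_conull]
  exact hμ

/-- Two probability measures on `[0, 1]` with the same distribution function on `[0, 1]` agree. -/
lemma ext_of_measureReal_Iic {μ ν : Measure ℝ} [IsProbabilityMeasure μ] [IsProbabilityMeasure ν]
    (hμ : ∀ᵐ t ∂μ, t ∈ Icc (0 : ℝ) 1) (hν : ∀ᵐ t ∂ν, t ∈ Icc (0 : ℝ) 1)
    (h : ∀ x ∈ Icc (0 : ℝ) 1, μ.real (Iic x) = ν.real (Iic x)) : μ = ν := by
  have hneg : ∀ ρ : Measure ℝ, (∀ᵐ t ∂ρ, t ∈ Icc (0 : ℝ) 1) → ∀ x < 0, ρ (Iic x) = 0 :=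
    fun ρ hρ x hx => measure_mono_null (show Iic x ⊆ (Icc 0 1)ᶜ from fun t ht ht' => by
      linarith [mem_Iic.1 ht, ht'.1]) (mem_ae_iff.1 hρ)
  have hone : ∀ ρ : Measure ℝ, IsProbabilityMeasure ρ → (∀ᵐ t ∂ρ, t ∈ Icc (0 : ℝ) 1) →
      ∀ x, 1 < x → ρ (Iic x) = 1 := fun ρ _ hρ x hx => by
    rw [← prob_compl_eq_zero_iff measurableSet_Iic]
    exact measure_mono_null (compl_subset_compl.2 fun t ht => ht.2.trans hx.le) (mem_ae_iff.1 hρ)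
  refine Measure.ext_of_Iic μ ν fun x => ?_
  rcases lt_or_ge x 0 with h0 | h0
  · rw [hneg μ hμ x h0, hneg ν hν x h0]
  rcases le_or_gt x 1 with h1 | h1
  · exact (measureReal_eq_measureReal_iff).1 (h x ⟨h0, h1⟩)
  · rw [hone μ inferInstance hμ x h1, hone ν inferInstance hν x h1]

/-- A measure whose distribution function is fixed by the transfer operator is stationary. -/
lemma stationary_of_cdfTransfer_eq {N : ℕ} {α p : Fin N → ℝ} (hα : ∀ j, 0 < α j)
    (hp : ∀ j, 0 < p j) (hp1 : ∑ j, p j = 1) {μ : Measure ℝ} [IsProbabilityMeasure μ]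
    (hμ : ∀ᵐ t ∂μ, t ∈ Icc (0 : ℝ) 1)
    (hF : ∀ x ∈ Icc (0 : ℝ) 1, cdfTransfer α p (fun x => μ.real (Iic x)) x = μ.real (Iic x))
    {A : Set ℝ} (hA : MeasurableSet A) :
    ∑ j, ENNReal.ofReal (p j) * μ (lsvMap (α j) ⁻¹' A) = μ A := by
  set ν : Measure ℝ := ∑ j, ENNReal.ofReal (p j) • μ.map (lsvMap (α j)) with hνdef
  have hν : ∀ B, MeasurableSet B → ν B = ∑ j, ENNReal.ofReal (p j) * μ (lsvMap (α j) ⁻¹' B) := by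
    intro B hB
    simp only [hνdef, Measure.coe_finsetSum, Finset.sum_apply, Measure.smul_apply, smul_eq_mul,
      Measure.map_apply (measurable_lsvMap _) hB]
  have hνp : IsProbabilityMeasure ν := ⟨by
    rw [hν _ MeasurableSet.univ]
    simp [← ENNReal.ofReal_sum_of_nonneg fun j _ => (hp j).le, hp1]⟩
  have hνm : ∀ᵐ t ∂ν, t ∈ Icc (0 : ℝ) 1 := by
    change ν (Icc (0 : ℝ) 1)ᶜ = 0
    rw [hν _ measurableSet_Icc.compl]
    refine Finset.sum_eq_zero fun j _ => ?_
    have hsub : Icc (0 : ℝ) 1 ⊆ lsvMap (α j) ⁻¹' Icc 0 1 := fun t ht => lsvMap_mem_Icc (hα j) ht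
    rw [preimage_compl, measure_mono_null (compl_subset_compl.2 hsub) (mem_ae_iff.1 hμ), mul_zero]
  rw [← hν A hA, ext_of_measureReal_Iic hνm hμ fun x hx => ?_]
  rw [Measure.real, hν _ measurableSet_Iic, toReal_sum_ofReal_mul hp,
    sum_mul_measureReal_lsvMap_preimage hα hμ hx, hF x hx]

/-- The distribution function of an absolutely continuous measure on `[0, 1]` is the primitive of
its density. -/
lemma integral_toReal_rnDeriv {μ : Measure ℝ} [IsFiniteMeasure μ]
    (hμ : μ ≪ volume.restrict (Icc (0 : ℝ) 1)) {x : ℝ}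
    (hx : 0 ≤ x) : ∫ t in (0 : ℝ)..x, (μ.rnDeriv volume t).toReal = μ.real (Iic x) := by
  have hac : μ ≪ volume := hμ.trans Measure.restrict_le_self.absolutelyContinuous
  rw [intervalIntegral.integral_of_le hx, Measure.setIntegral_toReal_rnDeriv hac]
  refine measureReal_congr ?_
  have h0 : ∀ᵐ t ∂μ, t ≠ 0 := hac.ae_le (Measure.ae_ne volume 0)
  filter_upwards [ae_mem_Icc_of_absolutelyContinuous hμ, h0] with t ht ht0
  exact propext ⟨fun h => h.2, fun h => ⟨lt_of_le_of_ne ht.1 ht0.symm, h⟩⟩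

end CumulativeMass

section CanonicalMeasure

variable {β γ m a : ℝ} {F f : ℝ → ℝ}

lemma IsLsvCone.withDensity_Iic (h : IsLsvCone β γ m a F f) (hγ : γ < 1) {x : ℝ}
    (hx : x ∈ Icc (0 : ℝ) 1) :
    (volume.restrict (Icc (0 : ℝ) 1)).withDensity (fun x => ENNReal.ofReal (f x)) (Iic x) =
      ENNReal.ofReal (F x) := by
  have hi : IntegrableOn f (Ioc 0 x) :=
    ((intervalIntegrable_iff_integrableOn_Ioc_of_le zero_le_one).1
      (h.intervalIntegrable hγ h.bound)).mono_set (Ioc_subset_Ioc_right hx.2)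
  have hs : Iic x ∩ Icc (0 : ℝ) 1 = Icc 0 x := by
    ext t
    simp only [mem_inter_iff, mem_Iic, mem_Icc]
    exact ⟨fun ⟨h1, h2, _⟩ => ⟨h2, h1⟩, fun ⟨h1, h2⟩ => ⟨h2, h1, h2.trans hx.2⟩⟩
  rw [withDensity_apply _ measurableSet_Iic, Measure.restrict_restrict measurableSet_Iic, hs,
    ← restrict_Ioc_eq_restrict_Icc, ← ofReal_integral_eq_lintegral_ofReal hi,
    ← intervalIntegral.integral_of_le hx.1, h.integral_eq hγ h.bound hx]
  filter_upwards [ae_restrict_mem measurableSet_Ioc] with t ht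
  exact h.nonneg t ⟨ht.1, ht.2.trans hx.2⟩

lemma IsLsvCone.isProbabilityMeasure (h : IsLsvCone β γ 1 a F f) (hγ : γ < 1) :
    IsProbabilityMeasure
      ((volume.restrict (Icc (0 : ℝ) 1)).withDensity (fun x => ENNReal.ofReal (f x))) := ⟨by
  have h1 := h.withDensity_Iic hγ (right_mem_Icc.2 zero_le_one)
  rw [h.one, ENNReal.ofReal_one] at h1
  rw [← h1]
  refine measure_congr ?_
  filter_upwards [ae_mem_Icc_of_absolutelyContinuous (withDensity_absolutelyContinuous _ _)]
    with t ht
  exact propext ⟨fun _ => ht.2, fun _ => trivial⟩⟩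

lemma IsLsvCone.density_le_rpow (h : IsLsvCone β γ m a F f) {x : ℝ} (hx : x ∈ Ioc (0 : ℝ) 1) :
    f x ≤ a * x ^ (-γ) := by
  have h1 := (h.mul_le_cdf hx).trans (h.bound x (Ioc_subset_Icc_self hx))
  rw [show 1 - γ = -γ + 1 by ring, Real.rpow_add_one hx.1.ne', ← mul_assoc] at h1
  exact le_of_mul_le_mul_right h1 hx.1

end CanonicalMeasure

lemma isLsvCone_one {β γ a : ℝ} (hβ : 0 ≤ β) (hγ : 0 < γ) (ha : 1 ≤ a) :
    IsLsvCone β γ 1 a (fun x => x) (fun _ => 1) := by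
  have := IsLsvCone.of_continuous (β := β) (γ := γ) (a := a) (f := fun _ => 1) continuous_const
    (fun _ _ => zero_le_one) antitoneOn_const
    (fun x hx y _ hxy => by
      simpa using Real.rpow_le_rpow hx.1.le hxy (by linarith : 0 ≤ 1 + β))
    hγ (zero_le_one.trans ha) (fun _ _ => ha)
  simpa using this

/-- For a random system of finitely many LSV maps with `α_min < 1`, there is a
unique absolutely continuous stationary probability measure; its density is
decreasing and continuous on `(0,1]` and bounded by `a x^{-α_min}`. -/
theorem lsv_random_system_acs
    (N : ℕ) (hN : 0 < N)
    (α : Fin N → ℝ) (hα : ∀ j, 0 < α j)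
    (αmin : ℝ) (hαmin : IsLeast (Set.range α) αmin) (hαmin1 : αmin < 1)
    (p : Fin N → ℝ) (hp : ∀ j, 0 < p j) (hp1 : ∑ j, p j = 1) :
    ∃ μ : Measure ℝ,
      (IsProbabilityMeasure μ ∧
        μ ≪ volume.restrict (Set.Icc (0 : ℝ) 1) ∧
        ∀ A : Set ℝ, MeasurableSet A → A ⊆ Set.Icc (0 : ℝ) 1 →
          ∑ j, ENNReal.ofReal (p j) * μ (lsvMap (α j) ⁻¹' A) = μ A) ∧
      (∀ μ' : Measure ℝ,
        (IsProbabilityMeasure μ' ∧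
          μ' ≪ volume.restrict (Set.Icc (0 : ℝ) 1) ∧
          ∀ A : Set ℝ, MeasurableSet A → A ⊆ Set.Icc (0 : ℝ) 1 →
            ∑ j, ENNReal.ofReal (p j) * μ' (lsvMap (α j) ⁻¹' A) = μ' A) → μ' = μ) ∧
      ∃ g : ℝ → ℝ,
        μ = (volume.restrict (Set.Icc (0 : ℝ) 1)).withDensity
              (fun x => ENNReal.ofReal (g x)) ∧
        AntitoneOn g (Set.Ioc (0 : ℝ) 1) ∧
        ContinuousOn g (Set.Ioc (0 : ℝ) 1) ∧
        ∃ a > (0 : ℝ), ∀ x ∈ Set.Ioc (0 : ℝ) 1, g x ≤ a * x ^ (-αmin) := by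
  obtain ⟨⟨i, rfl⟩, -⟩ := hαmin
  have hβ : ∀ j, α j ≤ ∑ k, α k := fun j =>
    Finset.single_le_sum (fun k _ => (hα k).le) (Finset.mem_univ j)
  have hκ : 0 < p i * ((1 - α i) / 2) := mul_pos (hp i) (by linarith)
  have ha : 1 ≤ max 1 (1 / (p i * ((1 - α i) / 2))) := le_max_left _ _
  obtain ⟨F, g, hC, -, hF, hg⟩ :=
    (isLsvCone_one ((hα i).le.trans (hβ i)) (hα i) ha).exists_fixed hα hp hp1 hβ i hαmin1
      (by
        rw [← div_le_iff₀' hκ]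
        exact le_max_right _ _)
  have hμp := hC.isProbabilityMeasure hαmin1
  set μ := (volume.restrict (Icc (0 : ℝ) 1)).withDensity (fun x => ENNReal.ofReal (g x))
  have hac : μ ≪ volume.restrict (Icc (0 : ℝ) 1) := withDensity_absolutelyContinuous _ _
  have hμ := ae_mem_Icc_of_absolutelyContinuous hac
  have hμF : ∀ x ∈ Icc (0 : ℝ) 1, μ.real (Iic x) = F x := fun x hx => by
    rw [Measure.real, hC.withDensity_Iic hαmin1 hx, ENNReal.toReal_ofReal (hC.cdf_nonneg hx)]
  have hcongr : ∀ H : ℝ → ℝ, (∀ x ∈ Icc (0 : ℝ) 1, H x = F x) → ∀ x ∈ Icc (0 : ℝ) 1,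
      cdfTransfer α p H x = cdfTransfer α p F x := fun H hH x hx => by
    rw [cdfTransfer_apply, cdfTransfer_apply]
    refine Finset.sum_congr rfl fun j _ => ?_
    rw [hH _ (lsvInv_mem_Icc (hα j) hx), hH ((x + 1) / 2)
      ⟨by linarith [hx.1], by linarith [hx.2]⟩, hH (1 / 2) (by norm_num)]
  refine ⟨μ, ⟨hμp, hac, fun A hA _ => ?_⟩, ?_, g, rfl, hC.anti, hC.continuousOn, _,
    zero_lt_one.trans_le ha, fun x hx => hC.density_le_rpow hx⟩
  · exact stationary_of_cdfTransfer_eq hα hp hp1 hμ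
      (fun x hx => by rw [hcongr _ hμF x hx, hF x hx, hμF x hx]) hA
  · rintro ν ⟨hνp, hνac, hνs⟩
    have hν := ae_mem_Icc_of_absolutelyContinuous hνac
    have hprim := fun x (hx : x ∈ Icc (0 : ℝ) 1) => integral_toReal_rnDeriv hνac hx.1
    refine ext_of_measureReal_Iic hν hμ fun x hx => ?_
    rw [hμF x hx, ← hprim x hx]
    refine eq_of_fixed_primitive hα hp hp1 hβ i hαmin1 hC hg Measure.integrable_toReal_rnDeriv
      ?_ (fun y hy => ?_) hx
    · rw [hprim 1 (by simp), Measure.real, (prob_compl_eq_zero_iff measurableSet_Iic).1,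
        ENNReal.toReal_one]
      exact measure_mono_null (compl_subset_compl.2 fun t ht => ht.2) (mem_ae_iff.1 hν)
    · rw [hprim y hy, ← cdfTransfer_eq_of_stationary hα hp hν hνs hy]
      rw [cdfTransfer_apply, cdfTransfer_apply]
      refine Finset.sum_congr rfl fun j _ => ?_
      rw [hprim _ (lsvInv_mem_Icc (hα j) hy), hprim ((y + 1) / 2)
        ⟨by linarith [hy.1], by linarith [hy.2]⟩, hprim (1 / 2) (by norm_num)]
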